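/- arXiv:1205.5314 — 2 statements merged into one kernel-verified Lean document; each statement's English description precedes it below -/
import Mathlib

section
/- Let Ω be an open bounded subset of ℝ^d and V a Hilbert space continuously embedded in C_0^2(Ω,ℝ^d). Then there exists a finite function F : ℝ × ℝ → ℝ, monotonically increasing in both arguments and independent of v, w, s, t, such that for all v, w ∈ V^{[0,1]} and s,t ∈ [0,1], ‖φ^v_{st} − φ^w_{st}‖_{1,∞} ≤ ‖v − w‖_{V^{[0,1]}} · F(‖v‖_{V^{[0,1]}}, ‖w‖_{V^{[0,1]}}), where ‖f‖_{1,∞} = sup_Ω |f| + sup_{|β|=1} sup_Ω |D^β f|. -/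
open MeasureTheory Set Filter
open scoped RealInnerProductSpace BigOperators Topology

noncomputable section

abbrev Euc (d : ℕ) := EuclideanSpace ℝ (Fin d)

/-- The `C^k` sup-norm `‖f‖_{k,∞} = Σ_{j≤k} sup_{|β|=j} sup_Ω |D^β f|` over `Ω`,
expressed via iterated Fréchet derivatives. -/
def CknormOn {d : ℕ} (k : ℕ) (Ω : Set (Euc d)) (f : Euc d → Euc d) : ℝ :=
  ∑ j ∈ Finset.range (k + 1), ⨆ x ∈ Ω, ‖iteratedFDeriv ℝ j f x‖

/-- Membership in `C_0^k(Ω, ℝ^d)`: `C^k` on `Ω`, with all derivatives of order `≤ k`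
extending continuously by `0` to the boundary of `Ω`. -/
def MemC0k {d : ℕ} (k : ℕ) (Ω : Set (Euc d)) (f : Euc d → Euc d) : Prop :=
  ContDiffOn ℝ k f Ω ∧
    ∀ j ≤ k, ∀ x ∈ frontier Ω,
      Tendsto (iteratedFDeriv ℝ j f) (𝓝[Ω] x) (𝓝 0)

/-- `v ∈ V^{[0,1]}`: a measurable map `[0,1] → V` with `∫₀¹ ‖v_t‖² dt < ∞`. -/
def InV01 {V : Type*} [NormedAddCommGroup V] [MeasurableSpace V] (v : ℝ → V) : Prop :=
  Measurable v ∧ IntegrableOn (fun t => ‖v t‖ ^ 2) (Icc (0:ℝ) 1)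

/-- The norm `‖v‖_{V^{[0,1]}} = (∫₀¹ ‖v_t‖² dt)^{1/2}`. -/
def normV01 {V : Type*} [NormedAddCommGroup V] (v : ℝ → V) : ℝ :=
  Real.sqrt (∫ t in (0:ℝ)..1, ‖v t‖ ^ 2)

/-- Divergence of a vector field: the trace of its Jacobian. -/
def divg {d : ℕ} (f : Euc d → Euc d) (x : Euc d) : ℝ :=
  LinearMap.trace ℝ (Euc d) (fderiv ℝ f x : Euc d →ₗ[ℝ] Euc d)

/-- A function `F : ℝ × ℝ → ℝ` monotonically increasing in both arguments. -/
def MonoBoth (F : ℝ → ℝ → ℝ) : Prop :=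
  (∀ b : ℝ, Monotone fun a => F a b) ∧ ∀ a : ℝ, Monotone fun b => F a b


lemma ac_exp_neg {K : ℝ → ℝ} {a b : ℝ} (hK : AbsolutelyContinuousOnInterval K a b)
    (h0 : ∀ t ∈ uIcc a b, 0 ≤ K t) :
    AbsolutelyContinuousOnInterval (fun t => Real.exp (-K t)) a b := by
  rw [absolutelyContinuousOnInterval_iff] at hK ⊢
  intro ε hε
  obtain ⟨δ, hδ, H⟩ := hK ε hε
  refine ⟨δ, hδ, fun E hE hs => lt_of_le_of_lt (Finset.sum_le_sum fun i hi => ?_) (H E hE hs)⟩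
  have h1 := h0 _ (hE.1 i hi).1
  have h2 := h0 _ (hE.1 i hi).2
  have key : ∀ x y : ℝ, 0 ≤ x → x ≤ y → Real.exp (-x) - Real.exp (-y) ≤ y - x := by
    intro x y hx hxy
    have e1 : Real.exp (-y) = Real.exp (-x) * Real.exp (-(y - x)) := by
      rw [← Real.exp_add]; ring_nf
    have e2 := Real.one_sub_le_exp_neg (y - x)
    have e3 : Real.exp (-x) ≤ 1 := by simpa using hx
    have e4 := Real.exp_pos (-x)
    rw [e1]
    nlinarith
  rw [Real.dist_eq, Real.dist_eq]
  rcases le_total (K (E.2 i).1) (K (E.2 i).2) with h | h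
  · have := key _ _ h1 h
    have h' : Real.exp (-K (E.2 i).2) ≤ Real.exp (-K (E.2 i).1) := by simpa using h
    rw [abs_of_nonneg (by linarith), abs_of_nonpos (by linarith)]; linarith
  · have := key _ _ h2 h
    have h' : Real.exp (-K (E.2 i).1) ≤ Real.exp (-K (E.2 i).2) := by simpa using h
    rw [abs_of_nonpos (by linarith), abs_of_nonneg (by linarith)]; linarith

lemma gron_fwd {k e : ℝ → ℝ} {a b C : ℝ} (hab : a ≤ b) (hk : IntervalIntegrable k volume a b)
    (hk0 : ∀ u, 0 ≤ k u) (he : ContinuousOn e (Icc a b))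
    (h : ∀ t ∈ Icc a b, e t ≤ C + ∫ u in a..t, k u * e u) :
    e b ≤ C * Real.exp (∫ u in a..b, k u) := by
  have hke : IntervalIntegrable (fun u => k u * e u) volume a b :=
    hk.mul_continuousOn (by rwa [uIcc_of_le hab])
  have acK := hk.absolutelyContinuousOnInterval_intervalIntegral (c := a) (by simp)
  have acG := hke.absolutelyContinuousOnInterval_intervalIntegral (c := a) (by simp)
  have acE := ac_exp_neg acK (by
    intro t ht
    rw [uIcc_of_le hab] at ht
    exact intervalIntegral.integral_nonneg ht.1 (fun u _ => hk0 u))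
  have acC : AbsolutelyContinuousOnInterval (fun _ : ℝ => C) a b :=
    ((LipschitzWith.const C).lipschitzOnWith).absolutelyContinuousOnInterval
  have acQ := (acC.fun_add acG).fun_mul acE
  have hI := acQ.integral_deriv_eq_sub
  have hle : ∫ x in a..b, deriv (fun t => (C + ∫ u in a..t, k u * e u) *
      Real.exp (-∫ u in a..t, k u)) x ≤ 0 := by
    rw [intervalIntegral.integral_of_le hab]
    apply integral_nonpos_of_ae
    rw [EventuallyLE, ae_restrict_iff' measurableSet_Ioc]
    filter_upwards [hk.ae_hasDerivAt_integral, hke.ae_hasDerivAt_integral] with x h1 h2 hx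
    have hx' : x ∈ uIcc a b := by rw [uIcc_of_le hab]; exact ⟨hx.1.le, hx.2⟩
    have d1 := h1 hx' a (by simp)
    have d2 := h2 hx' a (by simp)
    have := (d2.const_add C).mul d1.neg.exp
    rw [show (fun t => (C + ∫ u in a..t, k u * e u) * Real.exp (-∫ u in a..t, k u)) =
      (fun t => (C + ∫ u in a..t, k u * e u)) * (fun t => Real.exp (-∫ u in a..t, k u)) from rfl]
    erw [this.deriv]
    have h3 := h x ⟨hx.1.le, hx.2⟩
    have h4 := hk0 x
    have h5 := Real.exp_pos (-∫ u in a..x, k u)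
    simp only [Pi.neg_apply, Pi.zero_apply]
    nlinarith [mul_nonneg (mul_nonneg h4 h5.le) (sub_nonneg.2 h3)]
  rw [hI] at hle
  simp only [intervalIntegral.integral_same, add_zero, neg_zero, Real.exp_zero, mul_one] at hle
  have h6 := h b ⟨hab, le_rfl⟩
  set K := ∫ u in a..b, k u
  have h7 : (C + ∫ u in a..b, k u * e u) = ((C + ∫ u in a..b, k u * e u) * Real.exp (-K)) *
    Real.exp K := by rw [mul_assoc, ← Real.exp_add]; simp
  have := Real.exp_pos K
  nlinarith

lemma gron_bwd {k e : ℝ → ℝ} {a b C : ℝ} (hab : a ≤ b) (hk : IntervalIntegrable k volume a b)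
    (hk0 : ∀ u, 0 ≤ k u) (he : ContinuousOn e (Icc a b))
    (h : ∀ t ∈ Icc a b, e t ≤ C + ∫ u in t..b, k u * e u) :
    e a ≤ C * Real.exp (∫ u in a..b, k u) := by
  have := gron_fwd (k := fun u => k (-u)) (e := fun u => e (-u)) (a := -b) (b := -a) (C := C)
    (by linarith) ((IntervalIntegrable.iff_comp_neg (by simp)).1 hk).symm (fun u => hk0 _)
    (he.comp continuous_neg.continuousOn (fun u hu => ⟨by linarith [hu.2], by linarith [hu.1]⟩))
    (by
      intro t ht
      have := h (-t) ⟨by linarith [ht.2], by linarith [ht.1]⟩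
      rw [intervalIntegral.integral_comp_neg (fun u => k u * e u)]
      simpa using this)
  rw [intervalIntegral.integral_comp_neg (fun u => k u)] at this
  simpa using this

lemma gron {k e : ℝ → ℝ} {C s : ℝ} (hs : s ∈ Icc (0:ℝ) 1)
    (hk : IntervalIntegrable k volume 0 1)
    (hk0 : ∀ u, 0 ≤ k u) (he : ContinuousOn e (Icc 0 1)) (he0 : ∀ u, 0 ≤ e u) (hC : 0 ≤ C)
    (h : ∀ t ∈ Icc (0:ℝ) 1, e t ≤ C + |∫ u in s..t, k u * e u|) :
    ∀ t ∈ Icc (0:ℝ) 1, e t ≤ C * Real.exp (∫ u in (0:ℝ)..1, k u) := by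
  intro t ht
  have sub : ∀ a b : ℝ, 0 ≤ a → a ≤ b → b ≤ 1 → IntervalIntegrable k volume a b ∧
      ∫ u in a..b, k u ≤ ∫ u in (0:ℝ)..1, k u := by
    intro a b ha hab hb
    refine ⟨hk.mono_set (by
      rw [uIcc_of_le hab, uIcc_of_le zero_le_one]; exact Icc_subset_Icc ha hb), ?_⟩
    exact intervalIntegral.integral_mono_interval ha hab hb (Eventually.of_forall hk0) hk
  rcases le_total s t with hst | hst
  · obtain ⟨h1, h2⟩ := sub s t hs.1 hst ht.2
    have := gron_fwd hst h1 hk0 (he.mono (Icc_subset_Icc hs.1 ht.2)) (C := C) (by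
      intro r hr
      have := h r ⟨hs.1.trans hr.1, hr.2.trans ht.2⟩
      rwa [abs_of_nonneg (intervalIntegral.integral_nonneg hr.1
        (fun u _ => mul_nonneg (hk0 u) (he0 u)))] at this)
    exact this.trans (by gcongr)
  · obtain ⟨h1, h2⟩ := sub t s ht.1 hst hs.2
    have := gron_bwd hst h1 hk0 (he.mono (Icc_subset_Icc ht.1 hs.2)) (C := C) (by
      intro r hr
      have := h r ⟨ht.1.trans hr.1, hr.2.trans hs.2⟩
      rwa [intervalIntegral.integral_symm, abs_neg, abs_of_nonneg (intervalIntegral.integral_nonneg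
        hr.2 (fun u _ => mul_nonneg (hk0 u) (he0 u)))] at this)
    exact this.trans (by gcongr)

lemma simpson_aux {Y : Type*} [MetricSpace Y] [MeasurableSpace Y] [BorelSpace Y] {f : ℝ → Y}
    (hf : Measurable f) {ε : ℝ} (hε : 0 < ε) {N : Set Y} (hN : N ⊆ range f)
    (hsep : ∀ x ∈ N, ∀ y ∈ N, x ≠ y → ε < dist x y) : N.Countable := by
  classical
  by_contra hunc
  have hU : ∀ T : Set Y, MeasurableSet (f ⁻¹' (⋃ y ∈ T, Metric.ball y (ε / 2))) := fun T =>
    hf (isOpen_biUnion fun _ _ => Metric.isOpen_ball).measurableSet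
  choose! σ hσ using (fun y (hy : y ∈ N) => hN hy : ∀ y ∈ N, ∃ x, f x = y)
  have huniq : ∀ x, ∀ y ∈ N, ∀ z ∈ N, dist (f x) y < ε / 2 → dist (f x) z < ε / 2 → y = z := by
    intro x y hy z hz h1 h2
    by_contra hne
    have := hsep y hy z hz hne
    have := dist_triangle_left y z (f x)
    linarith
  -- the retraction
  let P : ℝ → Prop := fun x => ∃ y ∈ N, dist (f x) y < ε / 2
  let h : ℝ → ℝ := fun x => if hx : P x then σ hx.choose else x + 1
  have hh : ∀ x y, y ∈ N → dist (f x) y < ε / 2 → h x = σ y := by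
    intro x y hy hxy
    have hx : P x := ⟨y, hy, hxy⟩
    have h2 := hx.choose_spec
    have : hx.choose = y := huniq x _ h2.1 _ hy h2.2 hxy
    simp only [h, dif_pos hx, this]
  have hP : ∀ T ⊆ N, ∀ x, (x ∈ f ⁻¹' (⋃ y ∈ T, Metric.ball y (ε / 2))) ↔
      ∃ y ∈ T, dist (f x) y < ε / 2 := by
    intro T hT x; simp
  have hmeas : Measurable h := by
    intro B hB
    have : h ⁻¹' B = (f ⁻¹' (⋃ y ∈ {y ∈ N | σ y ∈ B}, Metric.ball y (ε / 2))) ∪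
        ((f ⁻¹' (⋃ y ∈ N, Metric.ball y (ε / 2)))ᶜ ∩ (fun x => x + 1) ⁻¹' B) := by
      ext x
      rw [mem_union, hP _ (fun y hy => hy.1), mem_inter_iff, mem_compl_iff, hP _ subset_rfl]
      by_cases hx : P x
      · obtain ⟨y, hy, hxy⟩ := hx
        have e := hh x y hy hxy
        simp only [mem_preimage, e]
        constructor
        · intro hb; exact Or.inl ⟨y, ⟨hy, hb⟩, hxy⟩
        · rintro (⟨z, ⟨hz, hzb⟩, hxz⟩ | ⟨h1, _⟩)
          · rwa [huniq x y hy z hz hxy hxz]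
          · exact absurd (show ∃ y ∈ N, dist (f x) y < ε / 2 from ⟨y, hy, hxy⟩) h1
      · have e : h x = x + 1 := by simp only [h, dif_neg hx]
        simp only [mem_preimage, e]
        constructor
        · intro hb; exact Or.inr ⟨hx, hb⟩
        · rintro (⟨z, ⟨hz, hzb⟩, hxz⟩ | ⟨h1, hb⟩)
          · exact absurd ⟨z, hz, hxz⟩ hx
          · exact hb
    rw [this]
    exact (hU _).union ((hU _).compl.inter ((measurable_id.add_const 1) hB))
  let S : Set ℝ := {x | h x = x}
  have hS : MeasurableSet S := measurableSet_eq_fun hmeas measurable_id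
  have hσS : ∀ y ∈ N, σ y ∈ S := by
    intro y hy
    exact hh _ y hy (by rw [hσ y hy]; simpa using hε)
  have hSσ : ∀ x ∈ S, ∃ y ∈ N, dist (f x) y < ε / 2 ∧ σ y = x := by
    intro x hx
    by_cases hp : P x
    · obtain ⟨y, hy, hxy⟩ := hp
      exact ⟨y, hy, hxy, by rw [← hh x y hy hxy]; exact hx⟩
    · have e : h x = x + 1 := by simp only [h, dif_neg hp]
      have hx' : h x = x := hx
      linarith
  have hSunc : ¬ S.Countable := by
    intro hc
    apply hunc
    refine Set.Countable.mono (fun y hy => ?_) (hc.image f)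
    exact ⟨σ y, hσS y hy, hσ y hy⟩
  have hall : ∀ T ⊆ S, MeasurableSet T := by
    intro T hT
    have : T = S ∩ f ⁻¹' (⋃ y ∈ {y ∈ N | σ y ∈ T}, Metric.ball y (ε / 2)) := by
      ext x
      rw [mem_inter_iff, hP _ (fun y hy => hy.1)]
      constructor
      · intro hx
        obtain ⟨y, hy, hxy, e⟩ := hSσ x (hT hx)
        exact ⟨hT hx, y, ⟨hy, by rwa [e]⟩, hxy⟩
      · rintro ⟨hx, y, ⟨hy, hyT⟩, hxy⟩
        have := hh x y hy hxy
        have hx' : h x = x := hx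
        rwa [← hx', this]
    rw [this]
    exact hS.inter (hU _)
  -- cardinality
  have : StandardBorelSpace S := hS.standardBorel
  have hSc : ¬ Countable S := fun hc => hSunc (countable_coe_iff.1 hc)
  have eqv : S ≃ᵐ ℝ := PolishSpace.measurableEquivOfNotCountable hSc
    (by rw [← Set.countable_univ_iff]; exact Cardinal.not_countable_real)
  have hallR : ∀ T : Set ℝ, MeasurableSet T := by
    intro T
    have h1 : MeasurableSet (Subtype.val '' (eqv ⁻¹' T)) := hall _ (by
      rintro _ ⟨x, _, rfl⟩; exact x.2)
    have h2 : MeasurableSet (eqv ⁻¹' T) := by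
      have := measurable_subtype_coe (p := (· ∈ S)) h1
      rwa [Set.preimage_image_eq _ Subtype.val_injective] at this
    rwa [eqv.measurableSet_preimage] at h2
  obtain ⟨b, hbc, hb⟩ := MeasurableSpace.CountablyGenerated.isCountablyGenerated (α := ℝ)
  have hcard := MeasurableSpace.cardinal_measurableSet_le_continuum (s := b)
    (hbc.le_aleph0.trans Cardinal.aleph0_le_continuum)
  rw [← hb] at hcard
  have : {t : Set ℝ | MeasurableSet t} = univ := by ext; simp [hallR]
  rw [this, Cardinal.mk_univ, Cardinal.mk_set, Cardinal.mk_real] at hcard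
  exact absurd hcard (not_le.2 (Cardinal.cantor _))

lemma simpson {Y : Type*} [MetricSpace Y] [MeasurableSpace Y] [BorelSpace Y] {f : ℝ → Y}
    (hf : Measurable f) : StronglyMeasurable f := by
  rw [stronglyMeasurable_iff_measurable_separable]
  refine ⟨hf, ?_⟩
  have := EMetric.subset_countable_closure_of_almost_dense_set (range f) (by
    intro ε hε
    obtain ⟨δ, hδ0, hδ⟩ := ENNReal.lt_iff_exists_nnreal_btwn.1 hε
    have hδ0' : 0 < δ := by simpa using hδ0
    obtain ⟨N, hN⟩ : ∃ N, Maximal (fun N ↦ N ⊆ range f ∧ Metric.IsSeparated (δ : ENNReal) N) N := by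
      have := zorn_subset {N : Set Y | N ⊆ range f ∧ Metric.IsSeparated (δ : ENNReal) N} (by
        intro c hc hch
        refine ⟨⋃₀ c, ⟨sUnion_subset fun N hN => (hc hN).1, ?_⟩, fun N hN => subset_sUnion_of_mem hN⟩
        exact (pairwise_sUnion hch.directedOn).2 fun N hN => (hc hN).2)
      exact this
    have hcov := Metric.IsCover.of_maximal_isSeparated hN
    refine ⟨N, simpson_aux hf (ε := δ) hδ0' hN.1.1 ?_, ?_⟩
    · intro x hx y hy hne
      have : (δ : ENNReal) < edist x y := hN.1.2 hx hy hne
      rw [edist_dist, ENNReal.lt_ofReal_iff_toReal_lt (by simp)] at this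
      simpa using this
    · rw [Metric.isCover_iff_subset_iUnion_closedEBall] at hcov
      exact hcov.trans (iUnion₂_mono fun _ _ => Metric.closedEBall_subset_closedEBall hδ.le))
  obtain ⟨t, -, htc, ht⟩ := this
  exact ⟨t, htc, ht⟩

lemma ext_bound {E F : Type*} [NormedAddCommGroup E] [NormedSpace ℝ E] [NormedAddCommGroup F]
    [NormedSpace ℝ F] {Ω : Set E} (hΩ : IsOpen Ω) {h : E → F} (hd : DifferentiableOn ℝ h Ω)
    (h0 : ∀ x ∈ frontier Ω, Tendsto h (𝓝[Ω] x) (𝓝 0)) {ε : ℝ} (hε : 0 ≤ ε) {y z : E} (hy : y ∈ Ω)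
    (hz : z ∉ Ω) (hb : ∀ p ∈ segment ℝ y z, p ∈ Ω → ‖fderiv ℝ h p‖ ≤ ε) :
    ‖h y‖ ≤ ε * ‖y - z‖ := by
  let γ : ℝ → E := fun θ => y + θ • (z - y)
  have hγ : Continuous γ := by fun_prop
  let S : Set ℝ := Icc 0 1 ∩ γ ⁻¹' Ωᶜ
  have hSc : IsCompact S := isCompact_Icc.inter_right (hΩ.isClosed_compl.preimage hγ)
  have hSn : S.Nonempty := ⟨1, ⟨by simp, by simpa [γ] using hz⟩⟩
  obtain ⟨τ, hτ, hmin⟩ := hSc.exists_isLeast hSn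
  have hτ0 : 0 < τ := by
    rcases hτ.1.1.lt_or_eq with h | h
    · exact h
    · exfalso; apply hτ.2; rw [← h]; simpa [γ] using hy
  have hin : ∀ θ ∈ Ico 0 τ, γ θ ∈ Ω := by
    intro θ hθ
    by_contra hcon
    have := hmin (show θ ∈ S from ⟨⟨hθ.1, hθ.2.le.trans hτ.1.2⟩, hcon⟩)
    linarith [hθ.2]
  have hseg : ∀ θ ∈ Icc (0:ℝ) 1, γ θ ∈ segment ℝ y z := by
    intro θ hθ
    rw [segment_eq_image']
    exact ⟨θ, hθ, rfl⟩
  have hle : ∀ θ ∈ Ico 0 τ, ‖h (γ θ) - h y‖ ≤ ε * ‖y - z‖ := by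
    intro θ hθ
    have hsub : ∀ p ∈ segment ℝ y (γ θ), ∃ θ' ∈ Icc 0 θ, p = γ θ' := by
      intro p hp
      rw [segment_eq_image'] at hp
      obtain ⟨a, ha, rfl⟩ := hp
      refine ⟨a * θ, ⟨mul_nonneg ha.1 hθ.1, mul_le_of_le_one_left hθ.1 ha.2⟩, ?_⟩
      simp [γ, smul_smul]
    have := Convex.norm_image_sub_le_of_norm_hasFDerivWithin_le (f := h) (f' := fderiv ℝ h)
      (C := ε) (s := segment ℝ y (γ θ)) (x := y) (y := γ θ) (𝕜 := ℝ)
      (by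
        intro p hp
        obtain ⟨θ', h1, rfl⟩ := hsub p hp
        have : γ θ' ∈ Ω := hin _ ⟨h1.1, h1.2.trans_lt hθ.2⟩
        exact ((hd _ this).differentiableAt (hΩ.mem_nhds this)).hasFDerivAt.hasFDerivWithinAt)
      (by
        intro p hp
        obtain ⟨θ', h1, rfl⟩ := hsub p hp
        exact hb _ (hseg _ ⟨h1.1, h1.2.trans (hθ.2.le.trans hτ.1.2)⟩)
          (hin _ ⟨h1.1, h1.2.trans_lt hθ.2⟩))
      (convex_segment _ _) (left_mem_segment _ _ _) (right_mem_segment _ _ _)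
    refine this.trans (mul_le_mul_of_nonneg_left ?_ hε)
    have hθ1 : θ ≤ 1 := hθ.2.le.trans hτ.1.2
    simp only [γ, add_sub_cancel_left, norm_smul, Real.norm_eq_abs, abs_of_nonneg hθ.1]
    rw [norm_sub_rev]
    exact mul_le_of_le_one_left (norm_nonneg _) hθ1
  have hev : ∀ᶠ θ in 𝓝[<] τ, θ ∈ Ico 0 τ := Ico_mem_nhdsLT hτ0
  have hγt : Tendsto γ (𝓝[<] τ) (𝓝[Ω] (γ τ)) := by
    refine tendsto_nhdsWithin_iff.2 ⟨hγ.continuousAt.tendsto.mono_left nhdsWithin_le_nhds, ?_⟩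
    filter_upwards [hev] with θ hθ using hin θ hθ
  have hfr : γ τ ∈ frontier Ω := by
    rw [hΩ.frontier_eq]
    refine ⟨mem_closure_iff_nhdsWithin_neBot.2 (hγt.neBot), hτ.2⟩
  have ht : Tendsto (fun θ => ‖h (γ θ) - h y‖) (𝓝[<] τ) (𝓝 ‖(0 : F) - h y‖) :=
    (((h0 _ hfr).comp hγt).sub_const (h y)).norm
  rw [zero_sub, norm_neg] at ht
  exact le_of_tendsto ht (hev.mono hle)

lemma ind_tendsto {E F : Type*} [TopologicalSpace E] [TopologicalSpace F] [Zero F] {Ω : Set E}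
    {h : E → F} {x : E} (ht : Tendsto h (𝓝[Ω] x) (𝓝 0)) :
    Tendsto (Ω.indicator h) (𝓝 x) (𝓝 0) := by
  classical
  intro U hU
  have := eventually_nhdsWithin_iff.1 (ht hU)
  rw [mem_map]
  filter_upwards [this] with y hy
  by_cases hyΩ : y ∈ Ω
  · simpa [hyΩ] using hy hyΩ
  · simpa [hyΩ] using mem_of_mem_nhds hU

lemma ext_hasFDerivAt {E F : Type*} [NormedAddCommGroup E] [NormedSpace ℝ E] [NormedAddCommGroup F]
    [NormedSpace ℝ F] {Ω : Set E} (hΩ : IsOpen Ω) {h : E → F} (hd : DifferentiableOn ℝ h Ω)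
    (h0 : ∀ x ∈ frontier Ω, Tendsto h (𝓝[Ω] x) (𝓝 0))
    (h1 : ∀ x ∈ frontier Ω, Tendsto (fderiv ℝ h) (𝓝[Ω] x) (𝓝 0)) (x : E) :
    HasFDerivAt (Ω.indicator h) (Ω.indicator (fderiv ℝ h) x) x := by
  classical
  by_cases hx : x ∈ Ω
  · rw [indicator_of_mem hx]
    refine ((hd x hx).differentiableAt (hΩ.mem_nhds hx)).hasFDerivAt.congr_of_eventuallyEq ?_
    filter_upwards [hΩ.mem_nhds hx] with y hy using indicator_of_mem hy _
  rw [indicator_of_notMem hx]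
  by_cases hcl : x ∈ closure Ω
  · have hfr : x ∈ frontier Ω := by rw [hΩ.frontier_eq]; exact ⟨hcl, hx⟩
    rw [hasFDerivAt_iff_isLittleO, Asymptotics.isLittleO_iff]
    intro ε hε
    have hT := ind_tendsto (h1 x hfr)
    obtain ⟨δ, hδ, H⟩ := Metric.tendsto_nhds_nhds.1 hT ε hε
    filter_upwards [Metric.ball_mem_nhds x hδ] with y hy
    by_cases hyΩ : y ∈ Ω
    · simp only [indicator_of_mem hyΩ, indicator_of_notMem hx, sub_zero,
        zero_apply]
      refine ext_bound hΩ hd h0 hε.le hyΩ hx ?_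
      intro p hp hpΩ
      have hpb : p ∈ Metric.ball x δ :=
        (convex_ball x δ).segment_subset hy (Metric.mem_ball_self hδ) hp
      have := H hpb
      rw [indicator_of_mem hpΩ, dist_zero_right] at this
      exact this.le
    · simp [hyΩ, hx]; positivity
  · refine (hasFDerivAt_const (0:F) x).congr_of_eventuallyEq ?_
    filter_upwards [isClosed_closure.isOpen_compl.mem_nhds hcl] with y hy
    exact indicator_of_notMem (fun h => hy (subset_closure h)) _

lemma sup_le_Cknorm {d k : ℕ} {Ω : Set (Euc d)} (hΩo : IsOpen Ω) (hΩb : Bornology.IsBounded Ω)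
    {f : Euc d → Euc d} (hf : MemC0k k Ω f) {K : ℝ} (hK : CknormOn k Ω f ≤ K) {j : ℕ} (hj : j ≤ k)
    {x : Euc d} (hx : x ∈ Ω) : ‖iteratedFDeriv ℝ j f x‖ ≤ K := by
  classical
  have hnn : ∀ i y, 0 ≤ ⨆ (_ : y ∈ Ω), ‖iteratedFDeriv ℝ i f y‖ := fun i y =>
    Real.iSup_nonneg fun _ => norm_nonneg _
  have hcont : ContinuousOn (iteratedFDeriv ℝ j f) Ω := by
    have := hf.1.continuousOn_iteratedFDerivWithin (m := j) (by exact_mod_cast hj)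
      hΩo.uniqueDiffOn
    refine this.congr fun y hy => ?_
    exact (iteratedFDerivWithin_of_isOpen j hΩo hy).symm
  have hc : ContinuousOn (Ω.indicator (iteratedFDeriv ℝ j f)) (closure Ω) := by
    intro y hy
    apply ContinuousAt.continuousWithinAt
    by_cases hyΩ : y ∈ Ω
    · refine (hcont.continuousAt (hΩo.mem_nhds hyΩ)).congr ?_
      filter_upwards [hΩo.mem_nhds hyΩ] with z hz using (indicator_of_mem hz _).symm
    · have := ind_tendsto (hf.2 j hj y (by rw [hΩo.frontier_eq]; exact ⟨hy, hyΩ⟩))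
      rw [ContinuousAt, indicator_of_notMem hyΩ]; exact this
  obtain ⟨M, hM⟩ := hΩb.isCompact_closure.exists_bound_of_continuousOn hc
  have hbdd : BddAbove (range fun y => ⨆ (_ : y ∈ Ω), ‖iteratedFDeriv ℝ j f y‖) := by
    refine ⟨max M 0, ?_⟩
    rintro _ ⟨y, rfl⟩
    refine Real.iSup_le (fun hy => ?_) (le_max_right _ _)
    have := hM y (subset_closure hy)
    rw [indicator_of_mem hy] at this
    exact this.trans (le_max_left _ _)
  have h1 : ‖iteratedFDeriv ℝ j f x‖ ≤ ⨆ y ∈ Ω, ‖iteratedFDeriv ℝ j f y‖ := by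
    refine le_trans ?_ (le_ciSup hbdd x)
    simp [hx]
  refine (h1.trans ?_).trans hK
  unfold CknormOn
  exact Finset.single_le_sum (f := fun j => ⨆ y ∈ Ω, ‖iteratedFDeriv ℝ j f y‖)
    (fun i _ => Real.iSup_nonneg fun y => hnn i y) (Finset.mem_range.2 (by omega))

lemma t2_aux {E F : Type*} [NormedAddCommGroup E] [NormedSpace ℝ E] [NormedAddCommGroup F]
    [NormedSpace ℝ F] {f : E → F} {l : Filter E} (h : Tendsto (iteratedFDeriv ℝ 2 f) l (𝓝 0)) :
    Tendsto (fderiv ℝ (fderiv ℝ f)) l (𝓝 0) := by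
  have h' := h.norm
  rw [norm_zero] at h'
  refine squeeze_zero_norm (E := E →L[ℝ] E →L[ℝ] F) (a := fun y => ‖iteratedFDeriv ℝ 2 f y‖)
    (fun y => ?_) h'
  rw [← norm_iteratedFDeriv_one, norm_iteratedFDeriv_fderiv]

set_option maxHeartbeats 1000000 in
lemma ext_props {d : ℕ} {Ω : Set (Euc d)} (hΩo : IsOpen Ω) (hΩb : Bornology.IsBounded Ω)
    {f : Euc d → Euc d} (hf : MemC0k 2 Ω f) {K : ℝ} (hK0 : 0 ≤ K) (hK : CknormOn 2 Ω f ≤ K) :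
    (∀ x, HasFDerivAt (Ω.indicator f) (Ω.indicator (fderiv ℝ f) x) x) ∧
    (∀ x, ‖Ω.indicator f x‖ ≤ K) ∧ (∀ x, ‖Ω.indicator (fderiv ℝ f) x‖ ≤ K) ∧
    (∀ x y, ‖Ω.indicator (fderiv ℝ f) x - Ω.indicator (fderiv ℝ f) y‖ ≤ K * ‖x - y‖) := by
  classical
  have n0 : ∀ x, ‖iteratedFDeriv ℝ 0 f x‖ = ‖f x‖ := fun x => norm_iteratedFDeriv_zero
  have n1 : ∀ x, ‖iteratedFDeriv ℝ 1 f x‖ = ‖fderiv ℝ f x‖ := fun x => norm_iteratedFDeriv_one f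
  have n2 : ∀ x, ‖iteratedFDeriv ℝ 2 f x‖ = ‖fderiv ℝ (fderiv ℝ f) x‖ := fun x => by
    rw [← norm_iteratedFDeriv_fderiv, norm_iteratedFDeriv_one]
  have t0 : ∀ x ∈ frontier Ω, Tendsto f (𝓝[Ω] x) (𝓝 0) := fun x hx => by
    have := (hf.2 0 (by norm_num) x hx).norm
    rw [norm_zero] at this
    exact squeeze_zero_norm (fun y => (n0 y).ge) this
  have t1 : ∀ x ∈ frontier Ω, Tendsto (fderiv ℝ f) (𝓝[Ω] x) (𝓝 0) := fun x hx => by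
    have := (hf.2 1 (by norm_num) x hx).norm
    rw [norm_zero] at this
    exact squeeze_zero_norm (fun y => (n1 y).ge) this
  have t2 : ∀ x ∈ frontier Ω, Tendsto (fderiv ℝ (fderiv ℝ f)) (𝓝[Ω] x) (𝓝 0) := fun x hx => by
    exact t2_aux (hf.2 2 (by norm_num) x hx)
  have d0 : DifferentiableOn ℝ f Ω := hf.1.differentiableOn (by norm_num)
  have d1 : DifferentiableOn ℝ (fderiv ℝ f) Ω :=
    (hf.1.fderiv_of_isOpen (m := 1) hΩo (by norm_num)).differentiableOn (by norm_num)
  have b : ∀ {j}, j ≤ 2 → ∀ x ∈ Ω, ‖iteratedFDeriv ℝ j f x‖ ≤ K := fun hj x hx =>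
    sup_le_Cknorm hΩo hΩb hf hK hj hx
  have H1 := ext_hasFDerivAt hΩo d0 t0 t1
  have H2 := ext_hasFDerivAt hΩo d1 t1 t2
  refine ⟨H1, fun x => ?_, fun x => ?_, fun x y => ?_⟩
  · by_cases hx : x ∈ Ω
    · rw [indicator_of_mem hx, ← n0]; exact b (by norm_num) x hx
    · simpa [hx] using hK0
  · by_cases hx : x ∈ Ω
    · rw [indicator_of_mem hx, ← n1]; exact b (by norm_num) x hx
    · simpa [hx] using hK0
  · refine Convex.norm_image_sub_le_of_norm_hasFDerivWithin_le (𝕜 := ℝ) (s := univ)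
      (fun x _ => (H2 x).hasFDerivWithinAt) (fun x _ => ?_) convex_univ (mem_univ _) (mem_univ _)
    by_cases hx : x ∈ Ω
    · rw [indicator_of_mem hx, ← n2]; exact b (by norm_num) x hx
    · simpa [hx] using hK0

lemma stay1 {d : ℕ} {Ω : Set (Euc d)} (hΩ : IsOpen Ω) {G A : ℝ → Euc d → Euc d} {k : ℝ → ℝ}
    {φ : ℝ → Euc d} {s T : ℝ} {x : Euc d} (hsT : s ≤ T) (hk : IntervalIntegrable k volume s T)
    (hk0 : ∀ u, 0 ≤ k u) (hGA : ∀ u, ∀ y ∈ Ω, G u y = A u y) (hA0 : ∀ u, ∀ y ∉ Ω, A u y = 0)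
    (hAl : ∀ u y z, ‖A u y - A u z‖ ≤ k u * ‖y - z‖)
    (hx : x ∈ Ω) (hφ : ∀ t ∈ Icc s T, φ t = x + ∫ u in s..t, G u (φ u))
    (hI : IntervalIntegrable (fun u => G u (φ u)) volume s T) : ∀ t ∈ Icc s T, φ t ∈ Ω := by
  have hc : ContinuousOn φ (Icc s T) := by
    have h1 := intervalIntegral.continuousOn_primitive_interval' hI (a := s) (by simp)
    rw [uIcc_of_le hsT] at h1
    exact (continuousOn_const.add h1).congr hφ
  by_contra! hcon
  obtain ⟨t, ht, htΩ⟩ := hcon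
  let S : Set ℝ := Icc s T ∩ φ ⁻¹' Ωᶜ
  have hSc : IsCompact S := isCompact_Icc.of_isClosed_subset
    (hc.preimage_isClosed_of_isClosed isClosed_Icc hΩ.isClosed_compl) inter_subset_left
  obtain ⟨τ, hτ, hmin⟩ := hSc.exists_isLeast ⟨t, ht, htΩ⟩
  have hin : ∀ u ∈ Icc s T, u < τ → φ u ∈ Ω := by
    intro u hu hlt
    by_contra hcon
    exact absurd (hmin (show u ∈ S from ⟨hu, hcon⟩)) (not_le.2 hlt)
  have hsub : Icc s τ ⊆ Icc s T := Icc_subset_Icc le_rfl hτ.1.2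
  have hkτ : IntervalIntegrable k volume s τ := hk.mono_set (by
    rw [uIcc_of_le hsT, uIcc_of_le hτ.1.1]; exact hsub)
  have he : ContinuousOn (fun u => ‖φ u - φ τ‖) (Icc s τ) :=
    ((hc.mono hsub).sub continuousOn_const).norm
  have hke : IntervalIntegrable (fun u => k u * ‖φ u - φ τ‖) volume s τ :=
    hkτ.mul_continuousOn (by rwa [uIcc_of_le hτ.1.1])
  have := gron_bwd (C := 0) (e := fun u => ‖φ u - φ τ‖) hτ.1.1 hkτ hk0 he (by
    intro r hr
    have e1 : φ r - φ τ = - ∫ u in r..τ, G u (φ u) := by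
      rw [hφ r (hsub hr), hφ τ hτ.1, ← intervalIntegral.integral_add_adjacent_intervals
        (a := s) (b := r) (c := τ)]
      · abel
      · exact hI.mono_set (by
          rw [uIcc_of_le hsT, uIcc_of_le hr.1]; exact Icc_subset_Icc le_rfl (hsub hr).2)
      · exact hI.mono_set (by
          rw [uIcc_of_le hsT, uIcc_of_le hr.2]; exact Icc_subset_Icc hr.1 hτ.1.2)
    rw [e1, norm_neg, zero_add]
    refine intervalIntegral.norm_integral_le_of_norm_le hr.2 ?_ (hke.mono_set (by
          rw [uIcc_of_le hτ.1.1, uIcc_of_le hr.2]; exact Icc_subset_Icc hr.1 le_rfl))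
    have hne : ∀ᵐ u : ℝ, u ≠ τ := by simp [ae_iff, measure_singleton]
    filter_upwards [hne] with u hu1 hu
    have hu2 : u < τ := lt_of_le_of_ne hu.2 hu1
    have h3 := hAl u (φ u) (φ τ)
    rw [hA0 u (φ τ) hτ.2, sub_zero] at h3
    rwa [hGA u _ (hin u ⟨hr.1.trans hu.1.le, hu.2.trans hτ.1.2⟩ hu2)])
  simp only [zero_mul] at this
  have h4 : φ s = φ τ := sub_eq_zero.1 (norm_le_zero_iff.1 this)
  have h5 : φ s = x := by rw [hφ s ⟨le_rfl, hsT⟩]; simp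
  exact hτ.2 (by rw [← h4, h5]; exact hx)

lemma stay_fwd {d : ℕ} {Ω : Set (Euc d)} (hΩ : IsOpen Ω) {G A : ℝ → Euc d → Euc d} {k : ℝ → ℝ}
    {φ : ℝ → Euc d} {s T : ℝ} {x : Euc d} (hsT : s ≤ T) (hk : IntervalIntegrable k volume s T)
    (hk0 : ∀ u, 0 ≤ k u) (hGA : ∀ u, ∀ y ∈ Ω, G u y = A u y) (hA0 : ∀ u, ∀ y ∉ Ω, A u y = 0)
    (hAb : ∀ u y, ‖A u y‖ ≤ k u)
    (hAl : ∀ u y z, ‖A u y - A u z‖ ≤ k u * ‖y - z‖)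
    (hAm : ∀ y, AEStronglyMeasurable (fun u => A u y) volume)
    (hx : x ∈ Ω) (hφ : ∀ t ∈ Icc s T, φ t = x + ∫ u in s..t, G u (φ u)) :
    IntervalIntegrable (fun u => G u (φ u)) volume s T ∧ ∀ t ∈ Icc s T, φ t ∈ Ω := by
  suffices hI : IntervalIntegrable (fun u => G u (φ u)) volume s T from
    ⟨hI, stay1 hΩ hsT hk hk0 hGA hA0 hAl hx hφ hI⟩
  let S : Set ℝ := {t | t ∈ Icc s T ∧ IntervalIntegrable (fun u => G u (φ u)) volume s t}
  have hsS : s ∈ S := ⟨⟨le_rfl, hsT⟩, by simp⟩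
  have hSb : BddAbove S := ⟨T, fun t ht => ht.1.2⟩
  set τ := sSup S with hτdef
  have hsτ : s ≤ τ := le_csSup hSb hsS
  have hτT : τ ≤ T := csSup_le ⟨s, hsS⟩ fun t ht => ht.1.2
  have hlt : ∀ t ∈ Icc s T, t < τ → IntervalIntegrable (fun u => G u (φ u)) volume s t := by
    intro t ht h
    obtain ⟨r, hr, htr⟩ := exists_lt_of_lt_csSup ⟨s, hsS⟩ h
    exact hr.2.mono_set (by
      rw [uIcc_of_le ht.1, uIcc_of_le hr.1.1]; exact Icc_subset_Icc le_rfl htr.le)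
  have hgt : ∀ t ∈ Icc s T, τ < t → φ t = x := by
    intro t ht h
    rw [hφ t ht, intervalIntegral.integral_undef, add_zero]
    intro hcon
    exact absurd (le_csSup hSb (show t ∈ S from ⟨ht, hcon⟩)) (not_le.2 h)
  have hinl : ∀ t ∈ Icc s T, t < τ → φ t ∈ Ω := by
    intro t ht h
    refine stay1 hΩ ht.1 (hk.mono_set ?_) hk0 hGA hA0 hAl hx
      (fun r hr => hφ r ⟨hr.1, hr.2.trans ht.2⟩) (hlt t ht h) t ⟨ht.1, le_rfl⟩
    rw [uIcc_of_le ht.1, uIcc_of_le hsT]; exact Icc_subset_Icc le_rfl ht.2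
  have hin : ∀ t ∈ Icc s T, t ≠ τ → φ t ∈ Ω := by
    intro t ht h
    rcases lt_or_gt_of_ne h with h | h
    · exact hinl t ht h
    · rw [hgt t ht h]; exact hx
  have hne : ∀ᵐ u : ℝ, u ≠ τ := by simp [ae_iff, measure_singleton]
  have hm1 : AEStronglyMeasurable (fun u => G u (φ u)) (volume.restrict (Ioo s τ)) := by
    have hsub : Ioo s τ ⊆ ⋃ n : ℕ, Ioc s (τ - 1 / ((n : ℝ) + 1)) := by
      intro u hu
      obtain ⟨n, hn⟩ := exists_nat_one_div_lt (sub_pos.2 hu.2)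
      exact mem_iUnion.2 ⟨n, hu.1, by linarith⟩
    refine AEStronglyMeasurable.mono_set hsub ?_
    rw [aestronglyMeasurable_iUnion_iff]
    intro n
    have hpos : 0 < 1 / ((n : ℝ) + 1) := by positivity
    by_cases h : s ≤ τ - 1 / ((n : ℝ) + 1)
    · exact (hlt _ ⟨h, by linarith⟩ (by linarith)).1.1
    · rw [Ioc_eq_empty (by linarith)]; simp
  have hm2 : AEStronglyMeasurable (fun u => G u (φ u)) (volume.restrict (Ioc τ T)) := by
    refine ((hAm x).restrict (s := Ioc τ T)).congr ?_
    rw [EventuallyEq, ae_restrict_iff' measurableSet_Ioc]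
    refine Eventually.of_forall fun u hu => ?_
    rw [hgt u ⟨hsτ.trans hu.1.le, hu.2⟩ hu.1, hGA u x hx]
  have hm : AEStronglyMeasurable (fun u => G u (φ u)) (volume.restrict (Ioc s T)) := by
    have h3 := (aestronglyMeasurable_union_iff (f := fun u => G u (φ u))).2 ⟨hm1, hm2⟩
    have h4 : (Ioo s τ ∪ Ioc τ T : Set ℝ) =ᵐ[volume] Ioc s T := by
      filter_upwards [hne] with u hu
      apply propext
      show (u ∈ Ioo s τ ∪ Ioc τ T) ↔ u ∈ Ioc s T
      constructor
      · rintro (h | h)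
        · exact ⟨h.1, h.2.le.trans hτT⟩
        · exact ⟨hsτ.trans_lt h.1, h.2⟩
      · intro h
        rcases lt_or_gt_of_ne hu with h' | h'
        · exact Or.inl ⟨h.1, h'⟩
        · exact Or.inr ⟨h', h.2⟩
    rwa [Measure.restrict_congr_set h4] at h3
  rw [intervalIntegrable_iff_integrableOn_Ioc_of_le hsT] at hk ⊢
  refine Integrable.mono' hk hm ?_
  rw [ae_restrict_iff' measurableSet_Ioc]
  filter_upwards [hne] with u hu1 hu
  rw [hGA u _ (hin u ⟨hu.1.le, hu.2⟩ hu1)]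
  exact hAb _ _

lemma stay {d : ℕ} {Ω : Set (Euc d)} (hΩ : IsOpen Ω) {G A : ℝ → Euc d → Euc d} {k : ℝ → ℝ}
    {φ : ℝ → Euc d} {s : ℝ} (hs : s ∈ Icc (0:ℝ) 1) {x : Euc d}
    (hk : IntervalIntegrable k volume 0 1)
    (hk0 : ∀ u, 0 ≤ k u) (hGA : ∀ u, ∀ y ∈ Ω, G u y = A u y) (hA0 : ∀ u, ∀ y ∉ Ω, A u y = 0)
    (hAb : ∀ u y, ‖A u y‖ ≤ k u)
    (hAl : ∀ u y z, ‖A u y - A u z‖ ≤ k u * ‖y - z‖)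
    (hAm : ∀ y, AEStronglyMeasurable (fun u => A u y) volume)
    (hx : x ∈ Ω) (hφ : ∀ t ∈ Icc (0:ℝ) 1, φ t = x + ∫ u in s..t, G u (φ u)) :
    IntervalIntegrable (fun u => A u (φ u)) volume 0 1 ∧ ContinuousOn φ (Icc 0 1) ∧
    ∀ t ∈ Icc (0:ℝ) 1, φ t = x + ∫ u in s..t, A u (φ u) := by
  have hsub1 : Icc s 1 ⊆ Icc 0 1 := Icc_subset_Icc hs.1 le_rfl
  have hsub2 : Icc 0 s ⊆ Icc 0 1 := Icc_subset_Icc le_rfl hs.2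
  have hk1 : IntervalIntegrable k volume s 1 := hk.mono_set (by
    rw [uIcc_of_le hs.2, uIcc_of_le zero_le_one]; exact hsub1)
  have hk2 : IntervalIntegrable k volume 0 s := hk.mono_set (by
    rw [uIcc_of_le hs.1, uIcc_of_le zero_le_one]; exact hsub2)
  obtain ⟨i1, m1⟩ := stay_fwd hΩ hs.2 hk1 hk0 hGA hA0 hAb hAl hAm hx
    (fun t ht => hφ t (hsub1 ht))
  obtain ⟨i2, m2⟩ := stay_fwd (G := fun u y => - G (-u) y) (A := fun u y => - A (-u) y)
    (k := fun u => k (-u)) (φ := fun u => φ (-u)) (s := -s) (T := 0) hΩ (by linarith [hs.1])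
    (by simpa using ((IntervalIntegrable.iff_comp_neg (by simp)).1 hk2).symm) (fun u => hk0 _)
    (fun u y hy => by simp only [hGA _ y hy])
    (fun u y hy => by simp only [hA0 _ y hy, neg_zero])
    (fun u y => by simpa using hAb (-u) y)
    (fun u y z => by
      rw [← neg_sub', norm_neg]; exact hAl (-u) y z)
    (fun y => ((hAm y).comp_measurePreserving (Measure.measurePreserving_neg volume)).neg) hx
    (by
      intro t ht
      have := hφ (-t) ⟨by linarith [ht.2], by linarith [ht.1, hs.2]⟩
      show φ (-t) = x + ∫ u in (-s)..t, - G (-u) (φ (-u))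
      rw [this, intervalIntegral.integral_neg,
        intervalIntegral.integral_comp_neg (fun u => G u (φ u)), neg_neg,
        ← intervalIntegral.integral_symm])
  have i3 : IntervalIntegrable (fun u => G u (φ u)) volume 0 s := by
    have := (IntervalIntegrable.iff_comp_neg (by simp)).1 i2.neg.symm
    simpa using this
  have hm : ∀ t ∈ Icc (0:ℝ) 1, φ t ∈ Ω := by
    intro t ht
    rcases le_total s t with h | h
    · exact m1 t ⟨h, ht.2⟩
    · simpa using m2 (-t) ⟨by linarith, by linarith [ht.1]⟩
  have iG := i3.trans i1
  have cong : ∀ u ∈ Icc (0:ℝ) 1, G u (φ u) = A u (φ u) := fun u hu => hGA u _ (hm u hu)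
  refine ⟨iG.congr (fun u hu => ?_), ?_, ?_⟩
  · rw [uIoc_of_le zero_le_one] at hu
    exact cong u ⟨hu.1.le, hu.2⟩
  · have h1 := intervalIntegral.continuousOn_primitive_interval' iG (a := s)
      (by rwa [uIcc_of_le zero_le_one])
    rw [uIcc_of_le zero_le_one] at h1
    exact (continuousOn_const.add h1).congr hφ
  · intro t ht
    rw [hφ t ht]
    congr 1
    refine intervalIntegral.integral_congr fun u hu => ?_
    exact cong u (by
      have := uIcc_subset_Icc hs ht hu
      exact this)

lemma second_diff {E : Type*} [NormedAddCommGroup E] [NormedSpace ℝ E] {g : E → E}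
    {B : E → E →L[ℝ] E} {K : ℝ} (hK0 : 0 ≤ K) (hg : ∀ x, HasFDerivAt g (B x) x)
    (hB : ∀ x, ‖B x‖ ≤ K) (hBl : ∀ x y, ‖B x - B y‖ ≤ K * ‖x - y‖) {a a' b b' : E} {M : ℝ}
    (hM : ‖a - b‖ ≤ M) (hM' : ‖a' - b'‖ ≤ M) :
    ‖(g a - g a') - (g b - g b')‖ ≤ K * ‖(a - a') - (b - b')‖ + K * M * ‖b - b'‖ := by
  let p : ℝ → E := fun θ => a' + θ • (a - a')
  let q : ℝ → E := fun θ => b' + θ • (b - b')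
  have hp : ∀ θ, HasDerivAt p (a - a') θ := fun θ => by
    have := ((hasDerivAt_id θ).smul_const (a - a')).const_add a'
    rw [one_smul] at this; exact this
  have hq : ∀ θ, HasDerivAt q (b - b') θ := fun θ => by
    have := ((hasDerivAt_id θ).smul_const (b - b')).const_add b'
    rw [one_smul] at this; exact this
  have hd : ∀ θ, HasDerivAt (fun θ => g (p θ) - g (q θ))
      (B (p θ) (a - a') - B (q θ) (b - b')) θ := fun θ =>
    ((hg (p θ)).comp_hasDerivAt θ (hp θ)).sub ((hg (q θ)).comp_hasDerivAt θ (hq θ))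
  have := norm_image_sub_le_of_norm_deriv_le_segment_01'
    (f := fun θ => g (p θ) - g (q θ)) (f' := fun θ => B (p θ) (a - a') - B (q θ) (b - b'))
    (C := K * ‖(a - a') - (b - b')‖ + K * M * ‖b - b'‖)
    (fun θ _ => (hd θ).hasDerivWithinAt) (by
      intro θ hθ
      have e1 : B (p θ) (a - a') - B (q θ) (b - b') =
          B (p θ) ((a - a') - (b - b')) + (B (p θ) - B (q θ)) (b - b') := by
        simp only [map_sub, sub_apply]; abel
      have e2 : p θ - q θ = (1 - θ) • (a' - b') + θ • (a - b) := by
        simp only [p, q]; module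
      have e3 : ‖p θ - q θ‖ ≤ M := by
        rw [e2]
        refine (norm_add_le _ _).trans ?_
        rw [norm_smul, norm_smul, Real.norm_of_nonneg hθ.1,
          Real.norm_of_nonneg (by linarith [hθ.2] : 0 ≤ 1 - θ)]
        nlinarith [hθ.1, hθ.2]
      rw [e1]
      refine (norm_add_le _ _).trans (add_le_add ?_ ?_)
      · exact (ContinuousLinearMap.le_opNorm _ _).trans (by gcongr; exact hB _)
      · refine (ContinuousLinearMap.le_opNorm _ _).trans ?_
        gcongr
        exact (hBl _ _).trans (by gcongr))
  have e : (g a - g a') - (g b - g b') = (g (p 1) - g (q 1)) - (g (p 0) - g (q 0)) := by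
    simp only [p, q, one_smul, zero_smul, add_zero, add_sub_cancel]; abel
  rw [e]; exact this

lemma gronP {E : Type*} [NormedAddCommGroup E] [NormedSpace ℝ E] {e f : ℝ → E} {p k : ℝ → ℝ}
    {s : ℝ} {x0 : E} (hs : s ∈ Icc (0:ℝ) 1) (hp : IntervalIntegrable p volume 0 1)
    (hp0 : ∀ u, 0 ≤ p u) (hk : IntervalIntegrable k volume 0 1) (hk0 : ∀ u, 0 ≤ k u)
    (he : ContinuousOn e (Icc 0 1)) (heq : ∀ t ∈ Icc (0:ℝ) 1, e t = x0 + ∫ u in s..t, f u)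
    (hf : ∀ u ∈ Icc (0:ℝ) 1, ‖f u‖ ≤ p u + k u * ‖e u‖) :
    ∀ t ∈ Icc (0:ℝ) 1,
      ‖e t‖ ≤ (‖x0‖ + ∫ u in (0:ℝ)..1, p u) * Real.exp (∫ u in (0:ℝ)..1, k u) := by
  have hke : IntervalIntegrable (fun u => k u * ‖e u‖) volume 0 1 :=
    hk.mul_continuousOn (by rw [uIcc_of_le zero_le_one]; exact he.norm)
  have hp1 : 0 ≤ ∫ u in (0:ℝ)..1, p u :=
    intervalIntegral.integral_nonneg zero_le_one fun u _ => hp0 u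
  refine gron hs hk hk0 he.norm (fun u => norm_nonneg _) (by positivity) ?_
  intro t ht
  have hsub : uIcc s t ⊆ uIcc 0 1 := by
    rw [uIcc_of_le zero_le_one]; exact uIcc_subset_Icc hs ht
  have ip := hp.mono_set hsub
  have ik := hke.mono_set hsub
  have h1 : ‖∫ u in s..t, f u‖ ≤ |∫ u in s..t, (p u + k u * ‖e u‖)| := by
    refine intervalIntegral.norm_integral_le_abs_of_norm_le ?_ (ip.add ik)
    rw [ae_restrict_iff' measurableSet_uIoc]
    refine Eventually.of_forall fun u hu => hf u ?_
    exact uIcc_subset_Icc hs ht (uIoc_subset_uIcc hu)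
  rw [intervalIntegral.integral_add ip ik] at h1
  have h2 : |∫ u in s..t, p u| ≤ ∫ u in (0:ℝ)..1, p u := by
    have := intervalIntegral.abs_integral_mono_interval (f := p) (μ := volume) (a := s) (b := t)
      (c := 0) (d := 1) (by
        rw [uIoc_of_le zero_le_one, uIoc]
        exact Ioc_subset_Ioc (le_min hs.1 ht.1) (max_le hs.2 ht.2)) (Eventually.of_forall hp0) hp
    rwa [abs_of_nonneg hp1] at this
  have h3 := abs_add_le (∫ u in s..t, p u) (∫ u in s..t, k u * ‖e u‖)
  have h4 : ‖e t‖ ≤ ‖x0‖ + ‖∫ u in s..t, f u‖ := by rw [heq t ht]; exact norm_add_le _ _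
  linarith

def IsPath {E : Type*} [NormedAddCommGroup E] [NormedSpace ℝ E] (A : ℝ → E → E) (s : ℝ) (x : E)
    (φ : ℝ → E) : Prop :=
  IntervalIntegrable (fun u => A u (φ u)) volume 0 1 ∧ ContinuousOn φ (Icc 0 1) ∧
    ∀ t ∈ Icc (0:ℝ) 1, φ t = x + ∫ u in s..t, A u (φ u)

lemma IsPath.sub_eq {E : Type*} [NormedAddCommGroup E] [NormedSpace ℝ E] {A A' : ℝ → E → E}
    {s : ℝ} {x y : E} {a b : ℝ → E} (hs : s ∈ Icc (0:ℝ) 1) (ha : IsPath A s x a)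
    (hb : IsPath A' s y b) {t : ℝ} (ht : t ∈ Icc (0:ℝ) 1) :
    a t - b t = (x - y) + ∫ u in s..t, (A u (a u) - A' u (b u)) := by
  have hsub : uIcc s t ⊆ uIcc 0 1 := by
    rw [uIcc_of_le zero_le_one]; exact uIcc_subset_Icc hs ht
  rw [ha.2.2 t ht, hb.2.2 t ht, intervalIntegral.integral_sub (ha.1.mono_set hsub)
    (hb.1.mono_set hsub)]
  abel

lemma path_lip {E : Type*} [NormedAddCommGroup E] [NormedSpace ℝ E] {A : ℝ → E → E}
    {s : ℝ} {x y : E} {a b : ℝ → E} (hs : s ∈ Icc (0:ℝ) 1) (ha : IsPath A s x a)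
    (hb : IsPath A s y b) {k : ℝ → ℝ} (hk : IntervalIntegrable k volume 0 1) (hk0 : ∀ u, 0 ≤ k u)
    (hA : ∀ u y z, ‖A u y - A u z‖ ≤ k u * ‖y - z‖) :
    ∀ t ∈ Icc (0:ℝ) 1, ‖a t - b t‖ ≤ ‖x - y‖ * Real.exp (∫ u in (0:ℝ)..1, k u) := by
  have := gronP (p := fun _ => 0) (e := fun t => a t - b t) hs (by simp) (fun _ => le_rfl) hk hk0
    (ha.2.1.sub hb.2.1) (fun t ht => ha.sub_eq hs hb ht) (fun u _ => by simpa using hA u _ _)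
  simpa using this

lemma path_stab {E : Type*} [NormedAddCommGroup E] [NormedSpace ℝ E] {A A' : ℝ → E → E}
    {s : ℝ} {x : E} {a b : ℝ → E} (hs : s ∈ Icc (0:ℝ) 1) (ha : IsPath A s x a)
    (hb : IsPath A' s x b) {k p : ℝ → ℝ} (hk : IntervalIntegrable k volume 0 1)
    (hk0 : ∀ u, 0 ≤ k u) (hp : IntervalIntegrable p volume 0 1) (hp0 : ∀ u, 0 ≤ p u)
    (hA : ∀ u y z, ‖A' u y - A' u z‖ ≤ k u * ‖y - z‖)
    (hD : ∀ u y, ‖A u y - A' u y‖ ≤ p u) :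
    ∀ t ∈ Icc (0:ℝ) 1, ‖a t - b t‖ ≤ (∫ u in (0:ℝ)..1, p u) * Real.exp (∫ u in (0:ℝ)..1, k u) := by
  have := gronP (p := p) (e := fun t => a t - b t) hs hp hp0 hk hk0
    (ha.2.1.sub hb.2.1) (fun t ht => ha.sub_eq hs hb ht) (fun u _ => by
      rw [← sub_add_sub_cancel _ (A' u (a u))]
      exact (norm_add_le _ _).trans (add_le_add (hD _ _) (hA _ _ _)))
  simpa using this

lemma path_stab1 {E : Type*} [NormedAddCommGroup E] [NormedSpace ℝ E] {A A' : ℝ → E → E}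
    {B' : ℝ → E → E →L[ℝ] E}
    {s : ℝ} {x y : E} {a a' b b' : ℝ → E} (hs : s ∈ Icc (0:ℝ) 1) (ha : IsPath A s x a)
    (ha' : IsPath A s y a') (hb : IsPath A' s x b) (hb' : IsPath A' s y b')
    {k k' p : ℝ → ℝ} (hk : IntervalIntegrable k volume 0 1)
    (hk0 : ∀ u, 0 ≤ k u) (hk' : IntervalIntegrable k' volume 0 1)
    (hk0' : ∀ u, 0 ≤ k' u) (hp : IntervalIntegrable p volume 0 1) (hp0 : ∀ u, 0 ≤ p u)
    (hA : ∀ u y z, ‖A u y - A u z‖ ≤ k u * ‖y - z‖)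
    (hA' : ∀ u y z, ‖A' u y - A' u z‖ ≤ k' u * ‖y - z‖)
    (hD : ∀ u y, ‖A u y - A' u y‖ ≤ p u)
    (hDl : ∀ u y z, ‖(A u y - A' u y) - (A u z - A' u z)‖ ≤ p u * ‖y - z‖)
    (hg : ∀ u x, HasFDerivAt (A' u) (B' u x) x)
    (hB : ∀ u x, ‖B' u x‖ ≤ k' u) (hBl : ∀ u x y, ‖B' u x - B' u y‖ ≤ k' u * ‖x - y‖) :
    ∀ t ∈ Icc (0:ℝ) 1, ‖(a t - b t) - (a' t - b' t)‖ ≤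
      ((∫ u in (0:ℝ)..1, p u) * Real.exp (∫ u in (0:ℝ)..1, k u) +
       (∫ u in (0:ℝ)..1, k' u) * ((∫ u in (0:ℝ)..1, p u) * Real.exp (∫ u in (0:ℝ)..1, k' u)) *
        Real.exp (∫ u in (0:ℝ)..1, k' u)) * Real.exp (∫ u in (0:ℝ)..1, k' u) * ‖x - y‖ := by
  have La := path_lip hs ha ha' hk hk0 hA
  have Lb := path_lip hs hb hb' hk' hk0' hA'
  have M1 := path_stab hs ha hb hk' hk0' hp hp0 hA' hD
  have M2 := path_stab hs ha' hb' hk' hk0' hp hp0 hA' hD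
  have hP0 : 0 ≤ ∫ u in (0:ℝ)..1, p u :=
    intervalIntegral.integral_nonneg zero_le_one fun u _ => hp0 u
  set M := (∫ u in (0:ℝ)..1, p u) * Real.exp (∫ u in (0:ℝ)..1, k' u) with hM
  set L1 := ‖x - y‖ * Real.exp (∫ u in (0:ℝ)..1, k u)
  set L2 := ‖x - y‖ * Real.exp (∫ u in (0:ℝ)..1, k' u)
  have hM0 : 0 ≤ M := by positivity
  have hL1 : 0 ≤ L1 := by positivity
  have hL2 : 0 ≤ L2 := by positivity
  have := gronP (p := fun u => p u * L1 + k' u * (M * L2))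
    (e := fun t => (a t - a' t) - (b t - b' t)) (x0 := (0 : E))
    (f := fun u => (A u (a u) - A u (a' u)) - (A' u (b u) - A' u (b' u))) (k := k') hs
    ((hp.mul_const _).add (hk'.mul_const _))
    (fun u => add_nonneg (mul_nonneg (hp0 u) hL1) (mul_nonneg (hk0' u) (mul_nonneg hM0 hL2)))
    hk' hk0' ((ha.2.1.sub ha'.2.1).sub (hb.2.1.sub hb'.2.1))
    (by
      intro t ht
      have hsub : uIcc s t ⊆ uIcc 0 1 := by
        rw [uIcc_of_le zero_le_one]; exact uIcc_subset_Icc hs ht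
      rw [ha.sub_eq hs ha' ht, hb.sub_eq hs hb' ht, intervalIntegral.integral_sub
        ((ha.1.sub ha'.1).mono_set hsub) ((hb.1.sub hb'.1).mono_set hsub)]
      abel)
    (by
      intro u hu
      have e1 : (A u (a u) - A u (a' u)) - (A' u (b u) - A' u (b' u)) =
        ((A u (a u) - A' u (a u)) - (A u (a' u) - A' u (a' u))) +
        ((A' u (a u) - A' u (a' u)) - (A' u (b u) - A' u (b' u))) := by abel
      have h1 := hDl u (a u) (a' u)
      have h2 := second_diff (hk0' u) (hg u) (hB u) (hBl u) (M1 u hu) (M2 u hu)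
      have h3 := mul_le_mul_of_nonneg_left (La u hu) (hp0 u)
      have h4 := mul_le_mul_of_nonneg_left (Lb u hu) (mul_nonneg (hk0' u) hM0)
      rw [e1]
      refine (norm_add_le _ _).trans ?_
      linarith)
  intro t ht
  have h5 := this t ht
  rw [intervalIntegral.integral_add (hp.mul_const _) (hk'.mul_const _),
    intervalIntegral.integral_mul_const, intervalIntegral.integral_mul_const, norm_zero,
    zero_add] at h5
  rw [show (a t - b t) - (a' t - b' t) = (a t - a' t) - (b t - b' t) by abel]
  refine h5.trans (le_of_eq ?_)
  simp only [L1, L2]; ring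

lemma cs01 {f : ℝ → ℝ} (hf : AEStronglyMeasurable f (volume.restrict (Icc 0 1)))
    (hf2 : IntegrableOn (fun t => f t ^ 2) (Icc (0:ℝ) 1)) :
    IntervalIntegrable f volume 0 1 ∧
      ∫ t in (0:ℝ)..1, f t ≤ Real.sqrt (∫ t in (0:ℝ)..1, f t ^ 2) := by
  have h1 : IntegrableOn f (Icc 0 1) := by
    refine Integrable.mono' (g := fun t => 1 + f t ^ 2)
      ((integrable_const (1:ℝ)).add hf2) hf (Eventually.of_forall fun t => ?_)
    rw [Real.norm_eq_abs]
    nlinarith [sq_nonneg (|f t| - 1), sq_abs (f t), abs_nonneg (f t)]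
  have i1 : IntervalIntegrable f volume 0 1 := by
    rw [intervalIntegrable_iff_integrableOn_Icc_of_le zero_le_one]; exact h1
  have i2 : IntervalIntegrable (fun t => f t ^ 2) volume 0 1 := by
    rw [intervalIntegrable_iff_integrableOn_Icc_of_le zero_le_one]; exact hf2
  refine ⟨i1, Real.le_sqrt_of_sq_le ?_⟩
  set m := ∫ t in (0:ℝ)..1, f t with hm
  have h3 : 0 ≤ ∫ t in (0:ℝ)..1, ((f t ^ 2 - (2 * m) * f t) + m ^ 2) :=
    intervalIntegral.integral_nonneg zero_le_one fun t _ => by nlinarith [sq_nonneg (f t - m)]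
  rw [intervalIntegral.integral_add (i2.sub (i1.const_mul _)) (by simp),
    intervalIntegral.integral_sub i2 (i1.const_mul _), intervalIntegral.integral_const_mul,
    ← hm] at h3
  simp at h3
  nlinarith

/-- `C^1` stability of the flow in the vector field: there is a finite
function `F`, increasing in both arguments and independent of `v, w, s, t`, with
`‖φ^v_{st} − φ^w_{st}‖_{1,∞} ≤ ‖v − w‖_{V^{[0,1]}} F(‖v‖_{V^{[0,1]}}, ‖w‖_{V^{[0,1]}})`. -/
theorem stmt_8 {d : ℕ} (Ω : Set (Euc d)) (hΩo : IsOpen Ω) (hΩb : Bornology.IsBounded Ω)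
    (V : Type*) [NormedAddCommGroup V] [InnerProductSpace ℝ V] [CompleteSpace V]
    [MeasurableSpace V] [BorelSpace V]
    (ι : V →ₗ[ℝ] (Euc d → Euc d)) (hinj : Function.Injective ι)
    (c : ℝ) (hc : 0 < c)
    (hemb : ∀ f : V, MemC0k 2 Ω (ι f) ∧ CknormOn 2 Ω (ι f) ≤ c * ‖f‖)
    (Φ : (ℝ → V) → ℝ → ℝ → Euc d → Euc d)
    (hflow : ∀ v : ℝ → V, InV01 v → ∀ s ∈ Icc (0:ℝ) 1, ∀ t ∈ Icc (0:ℝ) 1, ∀ x ∈ Ω,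
      Φ v s t x = x + ∫ u in s..t, ι (v u) (Φ v s u x)) :
    ∃ F : ℝ → ℝ → ℝ, MonoBoth F ∧
      ∀ v w : ℝ → V, InV01 v → InV01 w →
        ∀ s ∈ Icc (0:ℝ) 1, ∀ t ∈ Icc (0:ℝ) 1,
          CknormOn 1 Ω (fun x => Φ v s t x - Φ w s t x)
            ≤ normV01 (fun u => v u - w u) * F (normV01 v) (normV01 w) := by
  classical
  -- basic facts on the extended fields
  let A : V → Euc d → Euc d := fun f => Ω.indicator (ι f)
  let B : V → Euc d → Euc d →L[ℝ] Euc d := fun f => Ω.indicator (fderiv ℝ (ι f))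
  have hP : ∀ f : V, _ := fun f =>
    ext_props hΩo hΩb (hemb f).1 (mul_nonneg hc.le (norm_nonneg f)) (hemb f).2
  have hAd : ∀ f x, HasFDerivAt (A f) (B f x) x := fun f => (hP f).1
  have hAb : ∀ f x, ‖A f x‖ ≤ c * ‖f‖ := fun f => (hP f).2.1
  have hBb : ∀ f x, ‖B f x‖ ≤ c * ‖f‖ := fun f => (hP f).2.2.1
  have hBl : ∀ f x y, ‖B f x - B f y‖ ≤ c * ‖f‖ * ‖x - y‖ := fun f => (hP f).2.2.2
  have hAl : ∀ f x y, ‖A f x - A f y‖ ≤ c * ‖f‖ * ‖x - y‖ := fun f x y =>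
    Convex.norm_image_sub_le_of_norm_hasFDerivWithin_le (𝕜 := ℝ) (s := univ)
      (fun x _ => (hAd f x).hasFDerivWithinAt) (fun x _ => hBb f x) convex_univ
      (mem_univ _) (mem_univ _)
  have hAsub : ∀ f g x, A f x - A g x = A (f - g) x := by
    intro f g x
    by_cases hx : x ∈ Ω <;> simp [A, hx]
  have hAm : ∀ v : ℝ → V, InV01 v → ∀ y, AEStronglyMeasurable (fun u => A (v u) y) volume := by
    intro v hv y
    by_cases hy : y ∈ Ω
    · let L : V →L[ℝ] Euc d := LinearMap.mkContinuous ((LinearMap.proj y).comp ι) c (fun f => by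
        have := hAb f y
        simpa [A, hy] using this)
      have h1 : Measurable (fun u => L (v u)) := L.continuous.measurable.comp hv.1
      have h2 : (fun u => A (v u) y) = fun u => L (v u) := by
        funext u; simp [A, L, hy]
      rw [h2]; exact h1.aestronglyMeasurable
    · have h2 : (fun u => A (v u) y) = fun u => 0 := by
        funext u; simp [A, hy]
      rw [h2]; exact aestronglyMeasurable_const
  -- integrability
  have hint : ∀ v : ℝ → V, StronglyMeasurable v →
      IntegrableOn (fun t => ‖v t‖ ^ 2) (Icc (0:ℝ) 1) →
      IntervalIntegrable (fun u => c * ‖v u‖) volume 0 1 ∧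
      ∫ u in (0:ℝ)..1, c * ‖v u‖ ≤ c * normV01 v := by
    intro v hv hv2
    obtain ⟨h1, h2⟩ := cs01 (f := fun u => ‖v u‖) hv.norm.aestronglyMeasurable hv2
    refine ⟨h1.const_mul c, ?_⟩
    rw [intervalIntegral.integral_const_mul]
    exact mul_le_mul_of_nonneg_left h2 hc.le
  have hpath : ∀ v : ℝ → V, InV01 v → ∀ s ∈ Icc (0:ℝ) 1, ∀ x ∈ Ω,
      IsPath (fun u => A (v u)) s x (fun t => Φ v s t x) := by
    intro v hv s hs x hx
    exact stay hΩo (G := fun u => ι (v u)) (A := fun u => A (v u)) (k := fun u => c * ‖v u‖) hs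
      (hint v (simpson hv.1) hv.2).1 (fun u => by positivity)
      (fun u y hy => (indicator_of_mem hy _).symm) (fun u y hy => indicator_of_notMem hy _)
      (fun u y => hAb _ y) (fun u y z => hAl _ y z) (hAm v hv) hx
      (fun t ht => hflow v hv s hs t ht x hx)
  refine ⟨fun a b => c * Real.exp (c * b) + (c * Real.exp (c * a) +
    (c * Real.exp b) * (c * Real.exp (c * b)) * Real.exp (c * b)) * Real.exp (c * b),
    ⟨fun b a a' h => ?_, fun a b b' h => ?_⟩, ?_⟩
  · simp only; gcongr
  · simp only; gcongr
  intro v w hv hw s hs t ht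
  have sv := simpson hv.1
  have sw := simpson hw.1
  have sd : StronglyMeasurable (fun u => v u - w u) := sv.sub sw
  have hd2 : IntegrableOn (fun t => ‖v t - w t‖ ^ 2) (Icc (0:ℝ) 1) := by
    refine Integrable.mono' (g := fun t => 2 * ‖v t‖ ^ 2 + 2 * ‖w t‖ ^ 2)
      ((hv.2.const_mul 2).add (hw.2.const_mul 2)) (sd.norm.pow 2).aestronglyMeasurable
      (Eventually.of_forall fun t => ?_)
    rw [Real.norm_of_nonneg (by positivity)]
    have h1 := norm_sub_le (v t) (w t)
    have h2 := norm_nonneg (v t - w t)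
    nlinarith [sq_nonneg (‖v t‖ - ‖w t‖), norm_nonneg (v t), norm_nonneg (w t)]
  obtain ⟨iv, bv⟩ := hint v sv hv.2
  obtain ⟨iw, bw⟩ := hint w sw hw.2
  obtain ⟨id, bd⟩ := hint _ sd hd2
  have hnn : ∀ (f : V), 0 ≤ c * ‖f‖ := fun f => mul_nonneg hc.le (norm_nonneg f)
  have hD : ∀ u y, ‖A (v u) y - A (w u) y‖ ≤ c * ‖v u - w u‖ := fun u y => by
    rw [hAsub]; exact hAb _ _
  have hDl : ∀ u y z, ‖(A (v u) y - A (w u) y) - (A (v u) z - A (w u) z)‖ ≤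
      c * ‖v u - w u‖ * ‖y - z‖ := fun u y z => by
    rw [hAsub, hAsub]; exact hAl _ _ _
  set N := normV01 (fun u => v u - w u) with hN
  set a := normV01 v
  set b := normV01 w
  have hN0 : 0 ≤ N := Real.sqrt_nonneg _
  have hb0 : 0 ≤ b := Real.sqrt_nonneg _
  have hbe : b ≤ Real.exp b := by linarith [Real.add_one_le_exp b]
  have nv : 0 ≤ ∫ u in (0:ℝ)..1, c * ‖v u‖ :=
    intervalIntegral.integral_nonneg zero_le_one fun u _ => hnn _
  have nw : 0 ≤ ∫ u in (0:ℝ)..1, c * ‖w u‖ :=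
    intervalIntegral.integral_nonneg zero_le_one fun u _ => hnn _
  have nd : 0 ≤ ∫ u in (0:ℝ)..1, c * ‖v u - w u‖ :=
    intervalIntegral.integral_nonneg zero_le_one fun u _ => hnn _
  have E0 : ∀ x ∈ Ω, ‖Φ v s t x - Φ w s t x‖ ≤ N * (c * Real.exp (c * b)) := by
    intro x hx
    have := path_stab hs (hpath v hv s hs x hx) (hpath w hw s hs x hx) iw (fun u => hnn _) id
      (fun u => hnn _) (fun u y z => hAl _ y z) hD t ht
    refine this.trans ?_
    calc _ ≤ (c * N) * Real.exp (c * b) := by gcongr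
      _ = _ := by ring
  set C1 := (c * Real.exp (c * a) +
    (c * Real.exp b) * (c * Real.exp (c * b)) * Real.exp (c * b)) * Real.exp (c * b) with hC1
  have E1 : ∀ x ∈ Ω, ∀ y ∈ Ω, ‖(Φ v s t x - Φ w s t x) - (Φ v s t y - Φ w s t y)‖ ≤
      (N * C1) * ‖x - y‖ := by
    intro x hx y hy
    have := path_stab1 (B' := fun u => B (w u)) hs (hpath v hv s hs x hx) (hpath v hv s hs y hy)
      (hpath w hw s hs x hx) (hpath w hw s hs y hy)
      iv (fun u => hnn _) iw (fun u => hnn _) id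
      (fun u => hnn _) (fun u y z => hAl _ y z) (fun u y z => hAl _ y z) hD hDl
      (fun u => hAd (w u)) (fun u => hBb (w u)) (fun u => hBl (w u)) t ht
    refine this.trans ?_
    have h1 : ∫ u in (0:ℝ)..1, c * ‖w u‖ ≤ c * Real.exp b := bw.trans (by gcongr)
    calc _ ≤ ((c * N) * Real.exp (c * a) + (c * Real.exp b) * ((c * N) * Real.exp (c * b)) *
          Real.exp (c * b)) * Real.exp (c * b) * ‖x - y‖ := by gcongr
      _ = _ := by rw [hC1]; ring
  have hC10 : 0 ≤ C1 := by positivity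
  have hG0 : 0 ≤ N * (c * Real.exp (c * b)) := by positivity
  have hG1 : 0 ≤ N * C1 := by positivity
  rw [mul_add]
  unfold CknormOn
  rw [Finset.sum_range_succ, Finset.sum_range_one]
  refine add_le_add ?_ ?_
  · refine Real.iSup_le (fun x => Real.iSup_le (fun hx => ?_) hG0) hG0
    rw [norm_iteratedFDeriv_zero]
    exact E0 x hx
  · refine Real.iSup_le (fun x => Real.iSup_le (fun hx => ?_) hG1) hG1
    rw [norm_iteratedFDeriv_one]
    refine norm_fderiv_le_of_lip' ℝ hG1 ?_
    filter_upwards [hΩo.mem_nhds hx] with y hy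
    exact E1 y hy x hx
end
end

section
/- Let Ω be an open bounded subset of ℝ^d, V a Hilbert space continuously embedded in C_0^1(Ω,ℝ^d), and v, h ∈ V^{[0,1]}. Then for every x ∈ Ω, s,t ∈ [0,1], and ε ∈ ℝ, the map ε ↦ φ^{v+εh}_{st}(x) is differentiable and ∂_ε φ^{v+εh}_{st}(x) = ∫_s^t ( Dφ^{v+εh}_{ut} h_u ) ∘ φ^{v+εh}_{su}(x) du, where Dφ^{v+εh}_{ut} is the Jacobian matrix of the flow map φ^{v+εh}_{ut}. -/
open MeasureTheory Set Filter
open scoped RealInnerProductSpace BigOperators Topology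

noncomputable section

lemma exists_not_measurable_subset (R : Set ℝ) (hR : MeasurableSet R) (hu : ¬ R.Countable) :
    ∃ S ⊆ R, ¬ MeasurableSet S := by
  by_contra hcon
  push Not at hcon
  haveI : StandardBorelSpace R := hR.standardBorel
  have hR' : ¬ Countable R := by rwa [Set.countable_coe_iff]
  have hℝ : ¬ Countable ℝ := by
    rw [← Set.countable_univ_iff]; exact Cardinal.not_countable_real
  let e : R ≃ᵐ ℝ := PolishSpace.measurableEquivOfNotCountable hR' hℝ
  have hall : ∀ S : Set ℝ, MeasurableSet S := by
    intro S
    have h1 : MeasurableSet (e ⁻¹' S) := by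
      have := hcon (Subtype.val '' (e ⁻¹' S)) (by rintro _ ⟨x, -, rfl⟩; exact x.2)
      have h2 := measurable_subtype_coe (p := fun x => x ∈ R) this
      rwa [Set.preimage_image_eq _ Subtype.val_injective] at h2
    exact (e.measurableSet_preimage).1 h1
  obtain ⟨b, hb, hgen⟩ := MeasurableSpace.CountablyGenerated.isCountablyGenerated (α := ℝ)
  have h3 := MeasurableSpace.cardinal_measurableSet_le_continuum (s := b)
    ((Cardinal.mk_le_aleph0_iff.2 hb.to_subtype).trans Cardinal.aleph0_le_continuum)
  rw [← hgen] at h3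
  have h4 : {t : Set ℝ | MeasurableSet t} = univ := by ext t; simp [hall t]
  rw [h4, Cardinal.mk_univ, Cardinal.mk_set, Cardinal.mk_real] at h3
  exact absurd h3 (not_le.2 (Cardinal.cantor _))

lemma isSeparable_range_of_measurable {X : Type*} [MetricSpace X] [MeasurableSpace X]
    [BorelSpace X] (f : ℝ → X) (hf : Measurable f) : TopologicalSpace.IsSeparable (range f) := by
  have key : ∀ ε : ℝ, 0 < ε → ∃ t : Set X, t.Countable ∧ ∀ x ∈ range f, ∃ y ∈ t, dist x y < ε := by
    intro ε hε
    obtain ⟨A, hA⟩ := zorn_subset {N : Set X | N ⊆ range f ∧ N.Pairwise (fun a b => ε ≤ dist a b)}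
      (by
        intro C hC hch
        refine ⟨⋃₀ C, ⟨sUnion_subset fun s hs => (hC hs).1, ?_⟩, fun s hs => subset_sUnion_of_mem hs⟩
        rw [Set.pairwise_sUnion hch.directedOn]
        exact fun s hs => (hC hs).2)
    have hAsep := hA.prop.2
    have hArange := hA.prop.1
    refine ⟨A, ?_, ?_⟩
    · by_contra hunc
      have hclosed : ∀ S ⊆ A, IsClosed S := by
        intro S hS
        refine Metric.isClosed_of_pairwise_le_dist hε (hAsep.mono hS)
      have hmeas : ∀ S ⊆ A, MeasurableSet (f ⁻¹' S) := fun S hS => hf (hclosed S hS).measurableSet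
      let g := Function.invFun f
      have hg : ∀ a ∈ A, f (g a) = a := fun a ha => Function.invFun_eq (hArange ha)
      classical
      let r : ℝ → ℝ := fun x => if f x ∈ A then g (f x) else x
      have hr : Measurable r := by
        intro S hS
        have : r ⁻¹' S = (f ⁻¹' {a ∈ A | g a ∈ S}) ∪ (S ∩ (f ⁻¹' A)ᶜ) := by
          ext x
          by_cases hx : f x ∈ A <;> simp [r, hx]
        rw [this]
        exact (hmeas _ (fun a ha => ha.1)).union (hS.inter (hmeas A subset_rfl).compl)
      let R : Set ℝ := (f ⁻¹' A) ∩ {x | r x = x}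
      have hR : MeasurableSet R := (hmeas A subset_rfl).inter (measurableSet_eq_fun hr measurable_id)
      have hRu : ¬ R.Countable := by
        intro hc
        apply hunc
        refine (hc.image f).mono ?_
        intro a ha
        refine ⟨g a, ⟨by simpa [hg a ha] using ha, ?_⟩, hg a ha⟩
        simp [r, hg a ha, ha]
      obtain ⟨S, hSR, hS⟩ := exists_not_measurable_subset R hR hRu
      apply hS
      have : S = R ∩ (f ⁻¹' {a ∈ A | g a ∈ S}) := by
        ext x
        constructor
        · intro hx
          refine ⟨hSR hx, (hSR hx).1, ?_⟩
          have h1 := (hSR hx).2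
          have h2 : f x ∈ A := (hSR hx).1
          simp only [mem_setOf_eq, r, h2, if_true] at h1
          rw [h1]; exact hx
        · rintro ⟨hxR, hxA, hx⟩
          have h1 := hxR.2
          simp only [mem_setOf_eq, r, hxA, if_true] at h1
          rwa [h1] at hx
      rw [this]
      exact hR.inter (hmeas _ (fun a ha => ha.1))
    · intro x hx
      by_contra hcon
      push Not at hcon
      have hxA : x ∉ A := fun h => by
        have := hcon x h; rw [dist_self] at this; linarith
      have : insert x A ⊆ A := hA.le_of_ge (y := insert x A) ⟨insert_subset hx hArange, by
        refine hAsep.insert_of_notMem hxA ?_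
        intro b hb
        exact ⟨hcon b hb, by rw [dist_comm]; exact hcon b hb⟩⟩ (subset_insert _ _)
      exact hxA (this (mem_insert _ _))
  have := EMetric.subset_countable_closure_of_almost_dense_set (range f) (by
    intro ε hε
    obtain ⟨δ, hδ, hδε⟩ := ENNReal.lt_iff_exists_real_btwn.1 hε
    have hδ0 : 0 < δ := by
      have := hδε.1
      exact ENNReal.ofReal_pos.1 this
    obtain ⟨t, ht, h⟩ := key δ hδ0
    refine ⟨t, ht, fun x hx => ?_⟩
    obtain ⟨y, hy, hxy⟩ := h x hx
    refine mem_biUnion hy ?_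
    rw [Metric.mem_closedEBall, edist_dist]
    exact (ENNReal.ofReal_le_ofReal hxy.le).trans hδε.2.le)
  obtain ⟨t, -, htc, ht⟩ := this
  exact ⟨t, htc, ht⟩

lemma stronglyMeasurable_of_measurable_real {X : Type*} [MetricSpace X] [MeasurableSpace X]
    [BorelSpace X] {f : ℝ → X} (hf : Measurable f) : StronglyMeasurable f :=
  stronglyMeasurable_iff_measurable_separable.2 ⟨hf, isSeparable_range_of_measurable f hf⟩

lemma InV01.add_smul {V : Type*} [NormedAddCommGroup V] [InnerProductSpace ℝ V]
    [MeasurableSpace V] [BorelSpace V] {v h : ℝ → V} (hv : InV01 v) (hh : InV01 h) (e : ℝ) :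
    InV01 (fun u => v u + e • h u) := by
  have hsv := stronglyMeasurable_of_measurable_real hv.1
  have hsh := stronglyMeasurable_of_measurable_real hh.1
  have hs : StronglyMeasurable (fun u => v u + e • h u) := hsv.add (hsh.const_smul e)
  refine ⟨hs.measurable, ?_⟩
  have : IntegrableOn (fun t => 2 * ‖v t‖ ^ 2 + 2 * e ^ 2 * ‖h t‖ ^ 2) (Icc (0:ℝ) 1) :=
    (hv.2.const_mul 2).add (hh.2.const_mul (2 * e ^ 2))
  refine this.mono' (hs.norm.pow 2).aestronglyMeasurable (ae_of_all _ fun t => ?_)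
  rw [Real.norm_of_nonneg (by positivity)]
  have h1 : ‖v t + e • h t‖ ≤ ‖v t‖ + |e| * ‖h t‖ := by
    refine (norm_add_le _ _).trans ?_
    rw [norm_smul, Real.norm_eq_abs]
  have h2 : ‖v t + e • h t‖ ^ 2 ≤ (‖v t‖ + |e| * ‖h t‖) ^ 2 := by gcongr
  have h3 := sq_abs e
  nlinarith [sq_nonneg (‖v t‖ - |e| * ‖h t‖)]

lemma InV01.integrable_norm {V : Type*} [NormedAddCommGroup V]
    [MeasurableSpace V] [BorelSpace V] {v : ℝ → V} (hv : InV01 v) :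
    IntegrableOn (fun t => ‖v t‖) (Icc (0:ℝ) 1) := by
  have : IntegrableOn (fun t => 1 + ‖v t‖ ^ 2) (Icc (0:ℝ) 1) :=
    (integrableOn_const (by simp)).add hv.2
  refine this.mono' (hv.1.norm).aestronglyMeasurable (ae_of_all _ fun t => ?_)
  rw [norm_norm]
  nlinarith [sq_nonneg (‖v t‖ - 1)]

lemma gronwall_fwd {a k : ℝ → ℝ} {p q δ : ℝ} (hpq : p ≤ q) (hk0 : ∀ u, 0 ≤ k u)
    (hk : IntervalIntegrable k volume p q) (ha : ContinuousOn a (Icc p q))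
    (ha0 : ∀ u ∈ Icc p q, 0 ≤ a u) (hδ : 0 ≤ δ)
    (h : ∀ t ∈ Icc p q, a t ≤ δ + ∫ u in p..t, k u * a u) (N : ℕ)
    (hN : ∫ u in p..q, k u ≤ N / 2) : a q ≤ 2 ^ N * δ := by
  have hka : IntervalIntegrable (fun u => k u * a u) volume p q :=
    hk.mul_continuousOn (by rwa [uIcc_of_le hpq])
  have hsub : ∀ {x y}, x ∈ Icc p q → y ∈ Icc p q → uIcc x y ⊆ uIcc p q := fun hx hy => by
    rw [uIcc_of_le hpq]; exact uIcc_subset_Icc hx hy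
  have hp : p ∈ Icc p q := ⟨le_rfl, hpq⟩
  set b : ℝ → ℝ := fun t => δ + ∫ u in p..t, k u * a u with hb
  set K : ℝ → ℝ := fun t => ∫ u in p..t, k u with hK
  have hKc : ContinuousOn K (Icc p q) := by
    have := intervalIntegral.continuousOn_primitive_interval (μ := volume) (f := k) (a := p) (b := q)
      (by rwa [uIcc_of_le hpq, ← intervalIntegrable_iff_integrableOn_Icc_of_le hpq])
    rwa [uIcc_of_le hpq] at this
  have hbdiff : ∀ x ∈ Icc p q, ∀ y ∈ Icc p q, b y - b x = ∫ u in x..y, k u * a u := by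
    intro x hx y hy
    have := intervalIntegral.integral_interval_sub_left (hka.mono_set (hsub hp hy))
      (hka.mono_set (hsub hp hx))
    simp only [hb]; linarith
  have hKdiff : ∀ x ∈ Icc p q, ∀ y ∈ Icc p q, K y - K x = ∫ u in x..y, k u := by
    intro x hx y hy
    exact intervalIntegral.integral_interval_sub_left (hk.mono_set (hsub hp hy))
      (hk.mono_set (hsub hp hx))
  have hbmono : ∀ x ∈ Icc p q, ∀ y ∈ Icc p q, x ≤ y → b x ≤ b y := by
    intro x hx y hy hxy
    have h1 := hbdiff x hx y hy
    have h2 : 0 ≤ ∫ u in x..y, k u * a u := intervalIntegral.integral_nonneg hxy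
      (fun u hu => mul_nonneg (hk0 u) (ha0 u ⟨hx.1.trans hu.1, hu.2.trans hy.2⟩))
    linarith
  have step : ∀ x ∈ Icc p q, ∀ y ∈ Icc p q, x ≤ y → b y - b x ≤ b y * (K y - K x) := by
    intro x hx y hy hxy
    rw [hbdiff x hx y hy, hKdiff x hx y hy, ← intervalIntegral.integral_const_mul]
    refine intervalIntegral.integral_mono_on hxy (hka.mono_set (hsub hx hy))
      ((hk.mono_set (hsub hx hy)).const_mul _) (fun u hu => ?_)
    have hu' : u ∈ Icc p q := ⟨hx.1.trans hu.1, hu.2.trans hy.2⟩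
    rw [mul_comm]
    exact mul_le_mul_of_nonneg_right ((h u hu').trans (hbmono u hu' y hy hu.2)) (hk0 u)
  have hbp : b p = δ := by simp [hb]
  have hKp : K p = 0 := by simp [hK]
  have hbnn : ∀ t ∈ Icc p q, 0 ≤ b t := fun t ht => by
    have := hbmono p hp t ht ht.1; linarith
  have claim : ∀ n : ℕ, ∀ t ∈ Icc p q, K t ≤ n / 2 → b t ≤ 2 ^ n * δ := by
    intro n
    induction n with
    | zero =>
      intro t ht hKt
      have h1 := step p hp t ht ht.1
      have h2 := hbnn t ht
      rw [hbp, hKp] at h1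
      norm_num at hKt ⊢
      nlinarith
    | succ n ih =>
      intro t ht hKt
      have : ∃ t1 ∈ Icc p t, K t - K t1 ≤ 1 / 2 ∧ K t1 ≤ n / 2 := by
        by_cases hc : K t ≤ 1 / 2
        · refine ⟨p, ⟨le_rfl, ht.1⟩, by rw [hKp]; linarith, by rw [hKp]; positivity⟩
        · push Not at hc
          have hiv := intermediate_value_Icc ht.1 (hKc.mono (Icc_subset_Icc_right ht.2))
          obtain ⟨t1, ht1, he⟩ := hiv (show K t - 1 / 2 ∈ Icc (K p) (K t) from
            ⟨by rw [hKp]; linarith, by linarith⟩)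
          refine ⟨t1, ht1, by linarith, ?_⟩
          push_cast at hKt
          linarith
      obtain ⟨t1, ht1, h1, h2⟩ := this
      have ht1' : t1 ∈ Icc p q := ⟨ht1.1, ht1.2.trans ht.2⟩
      have h3 := step t1 ht1' t ht ht1.2
      have h4 := ih t1 ht1' h2
      have h5 := hbnn t ht
      rw [pow_succ]
      nlinarith
  exact (h q ⟨hpq, le_rfl⟩).trans (claim N q ⟨hpq, le_rfl⟩ hN)

lemma gronwall {k : ℝ → ℝ} (hk0 : ∀ u, 0 ≤ k u) (hk : IntegrableOn k (Icc (0:ℝ) 1)) :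
    ∃ C : ℝ, 0 ≤ C ∧ ∀ s ∈ Icc (0:ℝ) 1, ∀ t ∈ Icc (0:ℝ) 1, ∀ (a : ℝ → ℝ) (δ : ℝ), 0 ≤ δ →
      ContinuousOn a (uIcc s t) → (∀ u ∈ uIcc s t, 0 ≤ a u) →
      (∀ u ∈ uIcc s t, a u ≤ δ + |∫ r in s..u, k r * a r|) → a t ≤ C * δ := by
  obtain ⟨N, hN⟩ := exists_nat_ge (2 * ∫ u in (0:ℝ)..1, k u)
  have hkI : IntervalIntegrable k volume 0 1 :=
    (intervalIntegrable_iff_integrableOn_Icc_of_le zero_le_one).2 hk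
  have hle : ∀ s ∈ Icc (0:ℝ) 1, ∀ t ∈ Icc (0:ℝ) 1, s ≤ t → ∫ u in s..t, k u ≤ N / 2 := by
    intro s hs t ht hst
    have : ∫ u in s..t, k u ≤ ∫ u in (0:ℝ)..1, k u :=
      intervalIntegral.integral_mono_interval hs.1 hst ht.2 (ae_of_all _ hk0) hkI
    linarith
  refine ⟨2 ^ N, by positivity, ?_⟩
  intro s hs t ht a δ hδ hac ha0 h
  have hkst : IntervalIntegrable k volume s t := hkI.mono_set (by
    rw [uIcc_of_le zero_le_one]; exact uIcc_subset_Icc hs ht)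
  rcases le_total s t with hst | hts
  · rw [uIcc_of_le hst] at hac ha0 h
    refine gronwall_fwd hst hk0 hkst hac ha0 hδ ?_ N (hle s hs t ht hst)
    intro u hu
    have h1 : 0 ≤ ∫ r in s..u, k r * a r := intervalIntegral.integral_nonneg hu.1
      (fun r hr => mul_nonneg (hk0 r) (ha0 r ⟨hr.1, hr.2.trans hu.2⟩))
    have h2 := h u hu
    rwa [abs_of_nonneg h1] at h2
  · rw [uIcc_of_ge hts] at hac ha0 h
    have := gronwall_fwd (a := fun u => a (-u)) (k := fun u => k (-u)) (p := -s) (q := -t) (δ := δ)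
      (by linarith) (fun u => hk0 _)
      ((IntervalIntegrable.iff_comp_neg (by simp)).1 hkst)
      (hac.comp continuousOn_neg (fun u hu => ⟨by linarith [hu.2], by linarith [hu.1]⟩))
      (fun u hu => ha0 _ ⟨by linarith [hu.2], by linarith [hu.1]⟩) hδ
      (by
        intro u hu
        have hu' : -u ∈ Icc t s := ⟨by linarith [hu.2], by linarith [hu.1]⟩
        rw [intervalIntegral.integral_comp_neg (fun u => k u * a u), neg_neg]
        have h1 : 0 ≤ ∫ r in (-u)..s, k r * a r := intervalIntegral.integral_nonneg hu'.2
          (fun r hr => mul_nonneg (hk0 r) (ha0 r ⟨hu'.1.trans hr.1, hr.2⟩))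
        have h2 := h (-u) hu'
        rwa [intervalIntegral.integral_symm, abs_neg, abs_of_nonneg h1] at h2)
      N (by
        rw [intervalIntegral.integral_comp_neg (fun u => k u), neg_neg, neg_neg]
        exact hle t ht s hs hts)
    simpa using this

/-- product rule -/
lemma prod_rule {f g : ℝ → ℝ} {F₀ s t : ℝ} (hf : IntervalIntegrable f volume s t)
    (hg : IntervalIntegrable g volume s t) :
    (F₀ + ∫ u in s..t, f u) * (∫ u in s..t, g u) =
      ∫ u in s..t, (f u * (∫ r in s..u, g r) + (F₀ + ∫ r in s..u, f r) * g u) := by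
  have hF : AbsolutelyContinuousOnInterval (fun x => F₀ + ∫ u in s..x, f u) s t :=
    AbsolutelyContinuousOnInterval.add
      ((LipschitzOnWith.of_dist_le_mul (K := 0) (by simp)).absolutelyContinuousOnInterval)
      (hf.absolutelyContinuousOnInterval_intervalIntegral left_mem_uIcc)
  have hG := hg.absolutelyContinuousOnInterval_intervalIntegral (c := s) left_mem_uIcc
  have := hF.integral_deriv_mul_eq_sub hG
  simp only [intervalIntegral.integral_same, mul_zero, sub_zero] at this
  rw [← this]
  apply intervalIntegral.integral_congr_ae
  filter_upwards [hf.ae_hasDerivAt_integral, hg.ae_hasDerivAt_integral] with x hx1 hx2 hx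
  have hx' := uIoc_subset_uIcc hx
  rw [((hx1 hx' s left_mem_uIcc).const_add F₀).deriv, (hx2 hx' s left_mem_uIcc).deriv]

lemma memC0k_bdd {d : ℕ} {Ω : Set (Euc d)} (hΩo : IsOpen Ω) (hΩb : Bornology.IsBounded Ω)
    {f : Euc d → Euc d} (hf : MemC0k 1 Ω f) (j : ℕ) (hj : j ≤ 1) :
    ∃ B, ∀ x ∈ Ω, ‖iteratedFDeriv ℝ j f x‖ ≤ B := by
  have hcont : ContinuousOn (iteratedFDeriv ℝ j f) Ω := by
    have h1 := hf.1.continuousOn_iteratedFDerivWithin (m := j) (by exact_mod_cast hj)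
      hΩo.uniqueDiffOn
    exact h1.congr (fun x hx => (iteratedFDerivWithin_of_isOpen j hΩo hx).symm)
  have hcpt : IsCompact (closure Ω) := hΩb.isCompact_closure
  have := hcpt.induction_on (p := fun S => ∃ B, ∀ x ∈ S ∩ Ω, ‖iteratedFDeriv ℝ j f x‖ ≤ B)
    ⟨0, by simp⟩
    (fun S T hST ⟨B, hB⟩ => ⟨B, fun x hx => hB x ⟨hST hx.1, hx.2⟩⟩)
    (fun S T ⟨B, hB⟩ ⟨B', hB'⟩ => ⟨max B B', fun x hx => by
      rcases hx.1 with h | h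
      · exact (hB x ⟨h, hx.2⟩).trans (le_max_left _ _)
      · exact (hB' x ⟨h, hx.2⟩).trans (le_max_right _ _)⟩)
    (by
      intro x hx
      have : ∃ l, Tendsto (iteratedFDeriv ℝ j f) (𝓝[Ω] x) (𝓝 l) := by
        by_cases hxΩ : x ∈ Ω
        · exact ⟨_, hcont x hxΩ⟩
        · exact ⟨0, hf.2 j hj x (by rw [hΩo.frontier_eq]; exact ⟨hx, hxΩ⟩)⟩
      obtain ⟨l, hl⟩ := this
      have h2 : ∀ᶠ y in 𝓝[Ω] x, ‖iteratedFDeriv ℝ j f y‖ < ‖l‖ + 1 :=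
        hl.norm.eventually_lt_const (by linarith)
      rw [eventually_nhdsWithin_iff] at h2
      exact ⟨_, mem_nhdsWithin_of_mem_nhds h2, ‖l‖ + 1, fun y hy => (hy.1 hy.2).le⟩)
  obtain ⟨B, hB⟩ := this
  exact ⟨B, fun x hx => hB x ⟨subset_closure hx, hx⟩⟩

lemma memC0k_le {d : ℕ} {Ω : Set (Euc d)} (hΩo : IsOpen Ω) (hΩb : Bornology.IsBounded Ω)
    {f : Euc d → Euc d} (hf : MemC0k 1 Ω f) (j : ℕ) (hj : j ≤ 1) (x : Euc d) (hx : x ∈ Ω) :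
    ‖iteratedFDeriv ℝ j f x‖ ≤ CknormOn 1 Ω f := by
  obtain ⟨B, hB⟩ := memC0k_bdd hΩo hΩb hf j hj
  have hbdd : BddAbove (range fun y => ⨆ (_ : y ∈ Ω), ‖iteratedFDeriv ℝ j f y‖) := by
    refine ⟨max B 0, ?_⟩
    rintro _ ⟨y, rfl⟩
    refine Real.iSup_le (fun hy => (hB y hy).trans (le_max_left _ _)) (le_max_right _ _)
  have h1 : ‖iteratedFDeriv ℝ j f x‖ ≤ ⨆ y ∈ Ω, ‖iteratedFDeriv ℝ j f y‖ := by
    refine le_trans ?_ (le_ciSup hbdd x)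
    simp [hx]
  refine h1.trans ?_
  unfold CknormOn
  refine Finset.single_le_sum (f := fun j => ⨆ y ∈ Ω, ‖iteratedFDeriv ℝ j f y‖)
    (fun i _ => Real.iSup_nonneg fun y => Real.iSup_nonneg fun _ => norm_nonneg _)
    (Finset.mem_range.2 (by omega))

lemma exit_bound {d : ℕ} {Ω : Set (Euc d)} (hΩo : IsOpen Ω)
    {f : Euc d → Euc d} (hf : MemC0k 1 Ω f) {L : ℝ} (hL : 0 ≤ L) (hfL : ∀ x ∈ Ω, ‖fderiv ℝ f x‖ ≤ L)
    {y p : Euc d} (hy : y ∈ Ω) (hp : p ∉ Ω) : ‖f y‖ ≤ L * ‖y - p‖ := by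
  let g : ℝ → Euc d := fun τ => y + τ • (p - y)
  have hg : Continuous g := by fun_prop
  let S : Set ℝ := Icc 0 1 ∩ g ⁻¹' Ωᶜ
  have hScl : IsClosed S := isClosed_Icc.inter (hΩo.isClosed_compl.preimage hg)
  have hS1 : (1:ℝ) ∈ S := ⟨by simp, by simpa [g] using hp⟩
  have hbdd : BddBelow S := ⟨0, fun x hx => hx.1.1⟩
  set T := sInf S with hT
  have hTS : T ∈ S := hScl.csInf_mem ⟨1, hS1⟩ hbdd
  have hT0 : 0 < T := by
    rcases hTS.1.1.lt_or_eq with h | h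
    · exact h
    · exfalso; apply hTS.2; rw [← h]; simpa [g] using hy
  have hin : ∀ τ ∈ Ico 0 T, g τ ∈ Ω := by
    intro τ hτ
    by_contra hcon
    exact absurd (csInf_le hbdd (show τ ∈ S from ⟨⟨hτ.1, hτ.2.le.trans hTS.1.2⟩, hcon⟩))
      (not_le.2 hτ.2)
  have hev : ∀ᶠ τ in 𝓝[<] T, τ ∈ Ico 0 T := Ico_mem_nhdsLT hT0
  have htend : Tendsto g (𝓝[<] T) (𝓝[Ω] (g T)) :=
    tendsto_nhdsWithin_iff.2 ⟨hg.continuousAt.tendsto.mono_left nhdsWithin_le_nhds,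
      hev.mono hin⟩
  have hfr : g T ∈ frontier Ω := by
    rw [hΩo.frontier_eq]
    refine ⟨mem_closure_of_tendsto (htend.mono_right nhdsWithin_le_nhds) (hev.mono hin), hTS.2⟩
  have h0 := ((hf.2 0 (by norm_num) _ hfr).comp htend).norm
  simp only [Function.comp_def, norm_iteratedFDeriv_zero, norm_zero] at h0
  have hbound : ∀ᶠ τ in 𝓝[<] T, ‖f y‖ ≤ L * ‖y - p‖ + ‖f (g τ)‖ := by
    filter_upwards [hev] with τ hτ
    have hseg : segment ℝ y (g τ) ⊆ Ω := by
      rw [segment_eq_image']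
      rintro _ ⟨θ, hθ, rfl⟩
      have := hin (θ * τ) ⟨mul_nonneg hθ.1 hτ.1, by nlinarith [hθ.1, hθ.2, hτ.1, hτ.2]⟩
      simpa [g, smul_smul] using this
    have := (convex_segment (𝕜 := ℝ) y (g τ)).norm_image_sub_le_of_norm_fderiv_le (𝕜 := ℝ) (f := f)
      (C := L)
      (fun z hz => (hf.1.contDiffAt (hΩo.mem_nhds (hseg hz))).differentiableAt (by norm_num))
      (fun z hz => hfL z (hseg hz)) (right_mem_segment ℝ y (g τ)) (left_mem_segment ℝ y (g τ))
    have h2 : ‖y - g τ‖ ≤ ‖y - p‖ := by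
      have : y - g τ = τ • (y - p) := by simp only [g]; module
      rw [this, norm_smul, Real.norm_of_nonneg hτ.1]
      have : τ ≤ 1 := hτ.2.le.trans hTS.1.2
      nlinarith [norm_nonneg (y - p)]
    have h3 : ‖f y‖ ≤ ‖f y - f (g τ)‖ + ‖f (g τ)‖ := by
      simpa using norm_add_le (f y - f (g τ)) (f (g τ))
    nlinarith
  have := ge_of_tendsto (tendsto_const_nhds.add h0) hbound
  simpa using this

/-- Properties of the extended embedding. -/
structure Emb {d : ℕ} {V : Type*} [NormedAddCommGroup V] [InnerProductSpace ℝ V]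
    (Ω : Set (Euc d)) (c : ℝ) (F : V →ₗ[ℝ] (Euc d → Euc d)) : Prop where
  op : IsOpen Ω
  cpos : 0 < c
  bd : ∀ f y, ‖F f y‖ ≤ c * ‖f‖
  lip : ∀ f y z, ‖F f y - F f z‖ ≤ c * ‖f‖ * ‖y - z‖
  zero : ∀ f, ∀ y ∉ Ω, F f y = 0
  diff : ∀ f, ∀ y ∈ Ω, DifferentiableAt ℝ (F f) y

def extMap {d : ℕ} {V : Type*} [NormedAddCommGroup V] [InnerProductSpace ℝ V]
    (Ω : Set (Euc d)) (ι : V →ₗ[ℝ] (Euc d → Euc d)) : V →ₗ[ℝ] (Euc d → Euc d) where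
  toFun f := Ω.indicator (ι f)
  map_add' f g := by rw [map_add]; exact Set.indicator_add _ _ _
  map_smul' a f := by rw [map_smul]; exact Set.indicator_const_smul Ω a (ι f)

lemma extMap_eq {d : ℕ} {V : Type*} [NormedAddCommGroup V] [InnerProductSpace ℝ V]
    (Ω : Set (Euc d)) (ι : V →ₗ[ℝ] (Euc d → Euc d)) (f : V) {y : Euc d} (hy : y ∈ Ω) :
    extMap Ω ι f y = ι f y := Set.indicator_of_mem hy _

lemma extMap_emb {d : ℕ} {V : Type*} [NormedAddCommGroup V] [InnerProductSpace ℝ V]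
    (Ω : Set (Euc d)) (hΩo : IsOpen Ω) (hΩb : Bornology.IsBounded Ω)
    (ι : V →ₗ[ℝ] (Euc d → Euc d)) (c : ℝ) (hc : 0 < c)
    (hemb : ∀ f : V, MemC0k 1 Ω (ι f) ∧ CknormOn 1 Ω (ι f) ≤ c * ‖f‖) :
    Emb Ω c (extMap Ω ι) := by
  have h0 : ∀ f, ∀ y ∉ Ω, extMap Ω ι f y = 0 := fun f y hy => Set.indicator_of_notMem hy _
  have hD : ∀ f, ∀ y ∈ Ω, ‖fderiv ℝ (ι f) y‖ ≤ c * ‖f‖ := fun f y hy => by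
    have := (memC0k_le hΩo hΩb (hemb f).1 1 le_rfl y hy).trans (hemb f).2
    rwa [norm_iteratedFDeriv_one] at this
  have hdiff : ∀ f, ∀ y ∈ Ω, DifferentiableAt ℝ (ι f) y := fun f y hy =>
    ((hemb f).1.1.contDiffAt (hΩo.mem_nhds hy)).differentiableAt (by norm_num)
  have hex : ∀ f y, ∀ p ∉ Ω, ‖extMap Ω ι f y‖ ≤ c * ‖f‖ * ‖y - p‖ := by
    intro f y p hp
    by_cases hy : y ∈ Ω
    · rw [extMap_eq Ω ι f hy]
      exact exit_bound hΩo (hemb f).1 (by positivity) (hD f) hy hp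
    · rw [h0 f y hy, norm_zero]; positivity
  refine ⟨hΩo, hc, ?_, ?_, h0, ?_⟩
  · intro f y
    by_cases hy : y ∈ Ω
    · rw [extMap_eq Ω ι f hy]
      have := (memC0k_le hΩo hΩb (hemb f).1 0 (by norm_num) y hy).trans (hemb f).2
      rwa [norm_iteratedFDeriv_zero] at this
    · rw [h0 f y hy, norm_zero]; positivity
  · intro f y z
    by_cases hseg : segment ℝ y z ⊆ Ω
    · rw [extMap_eq Ω ι f (hseg (left_mem_segment ℝ y z)),
        extMap_eq Ω ι f (hseg (right_mem_segment ℝ y z))]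
      exact (convex_segment (𝕜 := ℝ) y z).norm_image_sub_le_of_norm_fderiv_le (𝕜 := ℝ)
        (fun w hw => hdiff f w (hseg hw)) (fun w hw => hD f w (hseg hw))
        (right_mem_segment ℝ y z) (left_mem_segment ℝ y z)
    · obtain ⟨p, hp, hpΩ⟩ := Set.not_subset.1 hseg
      have h1 := hex f y p hpΩ
      have h2 := hex f z p hpΩ
      have h3 : ‖y - p‖ + ‖z - p‖ = ‖y - z‖ := by
        have := dist_add_dist_of_mem_segment hp
        rw [dist_eq_norm, dist_eq_norm, dist_eq_norm, norm_sub_rev p z] at this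
        exact this
      rw [← h3, mul_add]
      exact (norm_sub_le _ _).trans (add_le_add h1 h2)
  · intro f y hy
    refine (hdiff f y hy).congr_of_eventuallyEq ?_
    filter_upwards [hΩo.mem_nhds hy] with z hz
    exact extMap_eq Ω ι f hz

lemma ii01 {E : Type*} [NormedAddCommGroup E] {k : ℝ → E} (hk : IntegrableOn k (Icc (0:ℝ) 1))
    {s t : ℝ} (hs : s ∈ Icc (0:ℝ) 1) (ht : t ∈ Icc (0:ℝ) 1) : IntervalIntegrable k volume s t :=
  ((intervalIntegrable_iff_integrableOn_Icc_of_le zero_le_one).2 hk).mono_set (by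
    rw [uIcc_of_le zero_le_one]; exact uIcc_subset_Icc hs ht)

lemma traj_in {d : ℕ} {Ω : Set (Euc d)} (hΩo : IsOpen Ω) {G : ℝ → Euc d → Euc d} {k : ℝ → ℝ}
    (hk0 : ∀ u, 0 ≤ k u) (hk : IntegrableOn k (Icc (0:ℝ) 1))
    (hGl : ∀ u, ∀ y ∈ Ω, ∀ p ∉ Ω, ‖G u y‖ ≤ k u * ‖y - p‖)
    {s : ℝ} (hs : s ∈ Icc (0:ℝ) 1) {x : Euc d} (hx : x ∈ Ω) {γ : ℝ → Euc d}
    (hγ : ∀ t ∈ Icc s 1, γ t = x + ∫ u in s..t, G u (γ u)) {t : ℝ} (ht : t ∈ Icc s 1)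
    (hint : IntervalIntegrable (fun u => G u (γ u)) volume s t) :
    ∀ u ∈ Icc s t, γ u ∈ Ω := by
  by_contra hcon
  push Not at hcon
  obtain ⟨u0, hu0, hu0Ω⟩ := hcon
  have hcont : ContinuousOn γ (Icc s t) := by
    have h1 := intervalIntegral.continuousOn_primitive_interval (μ := volume)
      (f := fun u => G u (γ u)) (a := s) (b := t)
      (by rwa [uIcc_of_le ht.1, ← intervalIntegrable_iff_integrableOn_Icc_of_le ht.1])
    rw [uIcc_of_le ht.1] at h1
    refine ((continuousOn_const (c := x)).add h1).congr (fun u hu => hγ u ⟨hu.1, hu.2.trans ht.2⟩)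
  let S := Icc s t ∩ γ ⁻¹' Ωᶜ
  have hScl : IsClosed S := hcont.preimage_isClosed_of_isClosed isClosed_Icc hΩo.isClosed_compl
  have hbdd : BddBelow S := ⟨s, fun x hx => hx.1.1⟩
  have hTS : sInf S ∈ S := hScl.csInf_mem ⟨u0, hu0, hu0Ω⟩ hbdd
  set T := sInf S with hT
  have hin : ∀ u ∈ Icc s t, u < T → γ u ∈ Ω := by
    intro u hu huT
    by_contra hcon
    exact absurd (csInf_le hbdd (show u ∈ S from ⟨hu, hcon⟩)) (not_le.2 huT)
  have hT01 : T ∈ Icc (0:ℝ) 1 := ⟨hs.1.trans hTS.1.1, hTS.1.2.trans ht.2⟩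
  have hsub : Icc s T ⊆ Icc s t := Icc_subset_Icc_right hTS.1.2
  obtain ⟨C, hC, hgr⟩ := gronwall hk0 hk
  have hacont : ContinuousOn (fun u => ‖γ u - γ T‖) (Icc s T) :=
    ((hcont.mono hsub).sub continuousOn_const).norm
  have key := hgr T hT01 s hs (fun u => ‖γ u - γ T‖) 0 le_rfl
    (by rwa [uIcc_of_ge hTS.1.1]) (fun u _ => norm_nonneg _)
    (by
      rw [uIcc_of_ge hTS.1.1]
      intro u hu
      have hu01 : u ∈ Icc (0:ℝ) 1 := ⟨hs.1.trans hu.1, hu.2.trans hT01.2⟩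
      have e1 : γ u - γ T = ∫ r in T..u, G r (γ r) := by
        rw [hγ u ⟨hu.1, hu01.2⟩, hγ T ⟨hTS.1.1, hT01.2⟩, add_sub_add_left_eq_sub]
        refine intervalIntegral.integral_interval_sub_left (hint.mono_set ?_) (hint.mono_set ?_)
        · rw [uIcc_of_le hu.1, uIcc_of_le ht.1]; exact Icc_subset_Icc_right (hu.2.trans hTS.1.2)
        · rw [uIcc_of_le hTS.1.1, uIcc_of_le ht.1]; exact hsub
      rw [zero_add, e1]
      refine intervalIntegral.norm_integral_le_abs_of_norm_le ?_ ?_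
      · rw [uIoc_of_ge hu.2]
        have hne : ∀ᵐ r ∂(volume.restrict (Ioc u T)), r ≠ T :=
          ae_restrict_of_ae (by simp [ae_iff, measure_singleton])
        filter_upwards [hne, ae_restrict_mem measurableSet_Ioc] with r hr hr2
        exact hGl r _ (hin r ⟨hu.1.trans hr2.1.le, hr2.2.trans hTS.1.2⟩ (lt_of_le_of_ne hr2.2 hr)) _
          hTS.2
      · refine (ii01 hk hT01 hu01).mul_continuousOn (hacont.mono ?_)
        rw [uIcc_of_ge hu.2]; exact Icc_subset_Icc_left hu.1)
  simp only [mul_zero] at key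
  have h2 : γ s = γ T := by
    rw [← sub_eq_zero, ← norm_le_zero_iff]; exact key
  have h3 : γ s = x := by rw [hγ s ⟨le_rfl, hs.2⟩]; simp
  exact hTS.2 (by rw [← h2, h3]; exact hx)

lemma traj_fwd {d : ℕ} {Ω : Set (Euc d)} (hΩo : IsOpen Ω) {G : ℝ → Euc d → Euc d} {k : ℝ → ℝ}
    (hk0 : ∀ u, 0 ≤ k u) (hk : IntegrableOn k (Icc (0:ℝ) 1))
    (hGm : ∀ x ∈ Ω, AEStronglyMeasurable (fun u => G u x) volume)
    (hGb : ∀ u, ∀ y ∈ Ω, ‖G u y‖ ≤ k u)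
    (hGl : ∀ u, ∀ y ∈ Ω, ∀ p ∉ Ω, ‖G u y‖ ≤ k u * ‖y - p‖)
    {s : ℝ} (hs : s ∈ Icc (0:ℝ) 1) {x : Euc d} (hx : x ∈ Ω) {γ : ℝ → Euc d}
    (hγ : ∀ t ∈ Icc s 1, γ t = x + ∫ u in s..t, G u (γ u)) :
    IntervalIntegrable (fun u => G u (γ u)) volume s 1 ∧ ∀ t ∈ Icc s 1, γ t ∈ Ω := by
  have h1 : (1:ℝ) ∈ Icc s 1 := ⟨hs.2, le_rfl⟩
  suffices hI : IntervalIntegrable (fun u => G u (γ u)) volume s 1 from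
    ⟨hI, traj_in hΩo hk0 hk hGl hs hx hγ h1 hI⟩
  let I : Set ℝ := {t | t ∈ Icc s 1 ∧ IntervalIntegrable (fun u => G u (γ u)) volume s t}
  have hsI : s ∈ I := ⟨⟨le_rfl, hs.2⟩, by simp⟩
  have hbdd : BddAbove I := ⟨1, fun t ht => ht.1.2⟩
  have hnot : ∀ u ∈ Icc s 1, u ∉ I → γ u = x := by
    intro u hu huI
    rw [hγ u hu, intervalIntegral.integral_undef (fun h => huI ⟨hu, h⟩), add_zero]
  have hdown : ∀ t ∈ I, ∀ u ∈ Icc s t, u ∈ I := by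
    intro t ht u hu
    refine ⟨⟨hu.1, hu.2.trans ht.1.2⟩, ht.2.mono_set ?_⟩
    rw [uIcc_of_le hu.1, uIcc_of_le ht.1.1]; exact Icc_subset_Icc_right hu.2
  have hΩ : ∀ u ∈ Icc s 1, γ u ∈ Ω := by
    intro u hu
    by_cases huI : u ∈ I
    · exact traj_in hΩo hk0 hk hGl hs hx hγ huI.1 huI.2 u ⟨hu.1, le_rfl⟩
    · rw [hnot u hu huI]; exact hx
  obtain ⟨τ, -, hτ, hτI⟩ := exists_seq_tendsto_sSup ⟨s, hsI⟩ hbdd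
  set T := sSup I with hT
  have hmeas : AEStronglyMeasurable (fun u => G u (γ u)) (volume.restrict (Ioc s 1)) := by
    have hsub : Ioc s 1 ⊆ ((⋃ n, Ioc s (τ n)) ∪ {T}) ∪ (Ioc T 1 ∩ Ioc s 1) := by
      intro u hu
      rcases lt_trichotomy u T with h | h | h
      · obtain ⟨n, hn⟩ := (hτ.eventually_const_lt h).exists
        exact Or.inl (Or.inl (mem_iUnion.2 ⟨n, hu.1, hn.le⟩))
      · exact Or.inl (Or.inr h)
      · exact Or.inr ⟨⟨h, hu.2⟩, hu⟩
    refine AEStronglyMeasurable.mono_set hsub ?_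
    rw [aestronglyMeasurable_union_iff, aestronglyMeasurable_union_iff]
    refine ⟨⟨?_, ?_⟩, ?_⟩
    · rw [aestronglyMeasurable_iUnion_iff]
      intro n
      exact (hτI n).2.1.aestronglyMeasurable
    · have : volume.restrict ({T} : Set ℝ) = 0 := by simp
      rw [this]; exact aestronglyMeasurable_zero_measure _
    · refine ((hGm x hx).restrict (s := Ioc T 1 ∩ Ioc s 1)).congr ?_
      filter_upwards [ae_restrict_mem (measurableSet_Ioc.inter measurableSet_Ioc)] with u hu
      rw [hnot u ⟨hu.2.1.le, hu.2.2⟩ (fun h => absurd (le_csSup hbdd h) (not_le.2 hu.1.1))]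
  rw [intervalIntegrable_iff_integrableOn_Ioc_of_le hs.2]
  refine Integrable.mono' (hk.mono_set (t := Icc 0 1) (s := Ioc s 1)
    (fun u hu => ⟨hs.1.trans hu.1.le, hu.2⟩)) hmeas ?_
  filter_upwards [ae_restrict_mem measurableSet_Ioc] with u hu
  exact hGb u _ (hΩ u ⟨hu.1.le, hu.2⟩)

lemma traj {d : ℕ} {Ω : Set (Euc d)} (hΩo : IsOpen Ω) {G : ℝ → Euc d → Euc d} {k : ℝ → ℝ}
    (hk0 : ∀ u, 0 ≤ k u) (hk : IntegrableOn k (Icc (0:ℝ) 1))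
    (hGm : ∀ x ∈ Ω, AEStronglyMeasurable (fun u => G u x) volume)
    (hGb : ∀ u, ∀ y ∈ Ω, ‖G u y‖ ≤ k u)
    (hGl : ∀ u, ∀ y ∈ Ω, ∀ p ∉ Ω, ‖G u y‖ ≤ k u * ‖y - p‖)
    {s : ℝ} (hs : s ∈ Icc (0:ℝ) 1) {x : Euc d} (hx : x ∈ Ω) {γ : ℝ → Euc d}
    (hγ : ∀ t ∈ Icc (0:ℝ) 1, γ t = x + ∫ u in s..t, G u (γ u)) :
    IntegrableOn (fun u => G u (γ u)) (Icc 0 1) ∧ (∀ t ∈ Icc (0:ℝ) 1, γ t ∈ Ω) ∧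
      ContinuousOn γ (Icc 0 1) := by
  have hf := traj_fwd hΩo hk0 hk hGm hGb hGl hs hx (fun t ht => hγ t ⟨hs.1.trans ht.1, ht.2⟩)
  have hb := traj_fwd (G := fun u y => - G (1 - u) y) (k := fun u => k (1 - u))
    (γ := fun u => γ (1 - u)) (s := 1 - s) hΩo (fun u => hk0 _)
    (by
      have := (ii01 hk (s := 1) (t := 0) (by simp) (by simp)).comp_sub_left 1
      simp only [sub_self, sub_zero] at this
      exact (intervalIntegrable_iff_integrableOn_Icc_of_le zero_le_one).1 this)
    (fun x hx => ((hGm x hx).comp_measurePreserving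
      (Measure.measurePreserving_sub_left volume (1:ℝ))).neg)
    (fun u y hy => by rw [norm_neg]; exact hGb _ y hy)
    (fun u y hy p hp => by rw [norm_neg]; exact hGl _ y hy p hp)
    ⟨by linarith [hs.2], by linarith [hs.1]⟩ hx
    (by
      intro t ht
      rw [hγ (1 - t) ⟨by linarith [ht.2], by linarith [ht.1, hs.2]⟩,
        intervalIntegral.integral_neg,
        intervalIntegral.integral_comp_sub_left (fun u => G u (γ u)), sub_sub_cancel,
        ← intervalIntegral.integral_symm])
  have hbI : IntervalIntegrable (fun u => G u (γ u)) volume s 0 := by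
    have := (hb.1.comp_sub_left 1).neg
    simpa [Pi.neg_def] using this
  have hI : IntegrableOn (fun u => G u (γ u)) (Icc 0 1) :=
    (intervalIntegrable_iff_integrableOn_Icc_of_le zero_le_one).1 (hbI.symm.trans hf.1)
  refine ⟨hI, ?_, ?_⟩
  · intro t ht
    rcases le_total s t with h | h
    · exact hf.2 t ⟨h, ht.2⟩
    · simpa using hb.2 (1 - t) ⟨by linarith, by linarith [ht.1]⟩
  · have h1 := intervalIntegral.continuousOn_primitive_interval' (μ := volume)
      (f := fun u => G u (γ u)) (a := s) (b₁ := 0) (b₂ := 1)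
      (ii01 hI (by simp) (by simp)) (by rwa [uIcc_of_le zero_le_one])
    rw [uIcc_of_le zero_le_one] at h1
    exact ((continuousOn_const (c := x)).add h1).congr hγ

section flowsec
variable {d : ℕ} {V : Type*} [NormedAddCommGroup V] [InnerProductSpace ℝ V]
    [MeasurableSpace V] [BorelSpace V]
    {Ω : Set (Euc d)} {c : ℝ} {F : V →ₗ[ℝ] (Euc d → Euc d)}
    {Φ : (ℝ → V) → ℝ → ℝ → Euc d → Euc d}

/-- `Φ` is a flow of the extended fields, staying in `Ω`. -/
structure IsFlow (Ω : Set (Euc d)) (F : V →ₗ[ℝ] (Euc d → Euc d))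
    (Φ : (ℝ → V) → ℝ → ℝ → Euc d → Euc d) : Prop where
  mem : ∀ w : ℝ → V, InV01 w → ∀ s ∈ Icc (0:ℝ) 1, ∀ x ∈ Ω, ∀ t ∈ Icc (0:ℝ) 1, Φ w s t x ∈ Ω
  cont : ∀ w : ℝ → V, InV01 w → ∀ s ∈ Icc (0:ℝ) 1, ∀ x ∈ Ω,
    ContinuousOn (fun t => Φ w s t x) (Icc 0 1)
  eq : ∀ w : ℝ → V, InV01 w → ∀ s ∈ Icc (0:ℝ) 1, ∀ x ∈ Ω, ∀ t ∈ Icc (0:ℝ) 1,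
    Φ w s t x = x + ∫ u in s..t, F (w u) (Φ w s u x)

lemma Emb.continuous (hE : Emb Ω c F) : Continuous (fun p : V × Euc d => F p.1 p.2) := by
  rw [continuous_iff_continuousAt]
  rintro ⟨f0, y0⟩
  rw [ContinuousAt, tendsto_iff_norm_sub_tendsto_zero]
  have hlim : Tendsto (fun p : V × Euc d => c * ‖p.1 - f0‖ + c * ‖f0‖ * ‖p.2 - y0‖)
      (𝓝 (f0, y0)) (𝓝 0) := by
    have : Continuous (fun p : V × Euc d => c * ‖p.1 - f0‖ + c * ‖f0‖ * ‖p.2 - y0‖) := by fun_prop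
    simpa using this.tendsto (f0, y0)
  refine squeeze_zero (fun _ => norm_nonneg _) (fun p => ?_) hlim
  have h1 : F p.1 p.2 - F f0 y0 = F (p.1 - f0) p.2 + (F f0 p.2 - F f0 y0) := by
    rw [map_sub]; simp
  rw [h1]
  exact (norm_add_le _ _).trans (add_le_add (hE.bd _ _) (hE.lip _ _ _))

lemma Emb.aesm (hE : Emb Ω c F) {w : ℝ → V} (hw : InV01 w) {γ : ℝ → Euc d} {μ : Measure ℝ}
    (hγ : AEStronglyMeasurable γ μ) :
    AEStronglyMeasurable (fun u => F (w u) (γ u)) μ :=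
  hE.continuous.comp_aestronglyMeasurable
    ((stronglyMeasurable_of_measurable_real hw.1).aestronglyMeasurable.prodMk hγ)

lemma Emb.kint (_hE : Emb Ω c F) {w : ℝ → V} (hw : InV01 w) :
    IntegrableOn (fun u => c * ‖w u‖) (Icc (0:ℝ) 1) := hw.integrable_norm.const_mul c

lemma Emb.knn (hE : Emb Ω c F) (w : ℝ → V) (u : ℝ) : 0 ≤ c * ‖w u‖ :=
  mul_nonneg hE.cpos.le (norm_nonneg _)

lemma Emb.int (hE : Emb Ω c F) {w : ℝ → V} (hw : InV01 w) {γ : ℝ → Euc d}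
    (hγ : ContinuousOn γ (Icc 0 1)) : IntegrableOn (fun u => F (w u) (γ u)) (Icc (0:ℝ) 1) :=
  (hE.kint hw).mono' (hE.aesm hw (hγ.aestronglyMeasurable measurableSet_Icc))
    (ae_of_all _ fun _ => hE.bd _ _)

lemma Emb.fderiv_le (hE : Emb Ω c F) (f : V) (y z : Euc d) :
    ‖fderiv ℝ (F f) y z‖ ≤ c * ‖f‖ * ‖z‖ := by
  refine (ContinuousLinearMap.le_opNorm _ _).trans ?_
  gcongr
  have h0 : 0 ≤ c * ‖f‖ := mul_nonneg hE.cpos.le (norm_nonneg _)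
  have : LipschitzWith ⟨c * ‖f‖, h0⟩ (F f) := LipschitzWith.of_dist_le_mul (fun a b => by
    rw [dist_eq_norm, dist_eq_norm]; exact hE.lip f a b)
  exact norm_fderiv_le_of_lipschitz ℝ this

lemma Emb.aesmD (hE : Emb Ω c F) {w : ℝ → V} (hw : InV01 w) {γ ζ : ℝ → Euc d}
    (hγ : ContinuousOn γ (Icc 0 1)) (hγΩ : ∀ u ∈ Icc (0:ℝ) 1, γ u ∈ Ω)
    (hζ : ContinuousOn ζ (Icc 0 1)) :
    AEStronglyMeasurable (fun u => fderiv ℝ (F (w u)) (γ u) (ζ u))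
      (volume.restrict (Icc (0:ℝ) 1)) := by
  have hγm := hγ.aestronglyMeasurable (μ := volume) measurableSet_Icc
  have hζm := hζ.aestronglyMeasurable (μ := volume) measurableSet_Icc
  refine aestronglyMeasurable_of_tendsto_ae (𝓝[≠] (0:ℝ))
    (f := fun e u => e⁻¹ • (F (w u) (γ u + e • ζ u) - F (w u) (γ u))) ?_ ?_
  · intro e
    exact ((hE.aesm hw (hγm.add (hζm.const_smul e))).sub (hE.aesm hw hγm)).const_smul (e⁻¹ : ℝ)
  · filter_upwards [ae_restrict_mem measurableSet_Icc] with u hu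
    have := ((hE.diff (w u) _ (hγΩ u hu)).hasFDerivAt.hasLineDerivAt (ζ u)).tendsto_slope_zero
    simpa using this

lemma Emb.intD (hE : Emb Ω c F) {w : ℝ → V} (hw : InV01 w) {γ ζ : ℝ → Euc d}
    (hγ : ContinuousOn γ (Icc 0 1)) (hγΩ : ∀ u ∈ Icc (0:ℝ) 1, γ u ∈ Ω)
    (hζ : ContinuousOn ζ (Icc 0 1)) :
    IntegrableOn (fun u => fderiv ℝ (F (w u)) (γ u) (ζ u)) (Icc (0:ℝ) 1) :=
  ((hE.kint hw).mul_continuousOn hζ.norm isCompact_Icc).mono' (hE.aesmD hw hγ hγΩ hζ)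
    (ae_of_all _ fun _ => hE.fderiv_le _ _ _)

lemma gr_vec {k : ℝ → ℝ} (hk0 : ∀ u, 0 ≤ k u) (hk : IntegrableOn k (Icc (0:ℝ) 1)) :
    ∃ C : ℝ, 0 ≤ C ∧ ∀ s ∈ Icc (0:ℝ) 1, ∀ (ζ f : ℝ → Euc d) (m : ℝ → ℝ) (z : Euc d),
      ContinuousOn ζ (Icc 0 1) → IntegrableOn m (Icc (0:ℝ) 1) → (∀ u, 0 ≤ m u) →
      (∀ u ∈ Icc (0:ℝ) 1, ‖f u‖ ≤ k u * ‖ζ u‖ + m u) →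
      (∀ t ∈ Icc (0:ℝ) 1, ζ t = z + ∫ u in s..t, f u) →
      ∀ t ∈ Icc (0:ℝ) 1, ‖ζ t‖ ≤ C * (‖z‖ + ∫ u in (0:ℝ)..1, m u) := by
  obtain ⟨C, hC, hgr⟩ := gronwall hk0 hk
  refine ⟨C, hC, ?_⟩
  intro s hs ζ f m z hζ hm hm0 hf heq t ht
  have hsub : ∀ {x y}, x ∈ Icc (0:ℝ) 1 → y ∈ Icc (0:ℝ) 1 → uIcc x y ⊆ Icc (0:ℝ) 1 :=
    fun hx hy => uIcc_subset_Icc hx hy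
  have hm1 : 0 ≤ ∫ u in (0:ℝ)..1, m u :=
    intervalIntegral.integral_nonneg zero_le_one (fun u _ => hm0 u)
  refine hgr s hs t ht (fun u => ‖ζ u‖) _ (by positivity) (hζ.norm.mono (hsub hs ht))
    (fun _ _ => norm_nonneg _) ?_
  intro u hu
  have hu01 := hsub hs ht hu
  have hkz : IntervalIntegrable (fun r => k r * ‖ζ r‖) volume s u :=
    ii01 (hk.mul_continuousOn hζ.norm isCompact_Icc) hs hu01
  have h1 : ‖∫ r in s..u, f r‖ ≤ |∫ r in s..u, (k r * ‖ζ r‖ + m r)| := by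
    refine intervalIntegral.norm_integral_le_abs_of_norm_le ?_ (hkz.add (ii01 hm hs hu01))
    filter_upwards [ae_restrict_mem measurableSet_uIoc] with r hr
    exact hf r (hsub hs hu01 (uIoc_subset_uIcc hr))
  rw [intervalIntegral.integral_add hkz (ii01 hm hs hu01)] at h1
  have h2 : |∫ r in s..u, m r| ≤ |∫ r in (0:ℝ)..1, m r| := by
    refine intervalIntegral.abs_integral_mono_interval ?_ (ae_of_all _ hm0)
      (ii01 hm (by simp) (by simp))
    rw [uIoc_of_le zero_le_one]
    exact Ioc_subset_Ioc (le_min hs.1 hu01.1) (max_le hs.2 hu01.2)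
  rw [abs_of_nonneg hm1] at h2
  have h3 := abs_add_le (∫ r in s..u, k r * ‖ζ r‖) (∫ r in s..u, m r)
  have h4 : ‖ζ u‖ ≤ ‖z‖ + ‖∫ r in s..u, f r‖ := by
    rw [heq u hu01]; exact norm_add_le _ _
  linarith

lemma isFlow_of (hE : Emb Ω c F) (ι : V →ₗ[ℝ] (Euc d → Euc d))
    (hι : ∀ f, ∀ y ∈ Ω, F f y = ι f y)
    (hflow : ∀ v : ℝ → V, InV01 v → ∀ s ∈ Icc (0:ℝ) 1, ∀ t ∈ Icc (0:ℝ) 1, ∀ x ∈ Ω,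
      Φ v s t x = x + ∫ u in s..t, ι (v u) (Φ v s u x)) : IsFlow Ω F Φ := by
  have key : ∀ w : ℝ → V, InV01 w → ∀ s ∈ Icc (0:ℝ) 1, ∀ x ∈ Ω,
      IntegrableOn (fun u => ι (w u) (Φ w s u x)) (Icc 0 1) ∧
      (∀ t ∈ Icc (0:ℝ) 1, Φ w s t x ∈ Ω) ∧ ContinuousOn (fun t => Φ w s t x) (Icc 0 1) := by
    intro w hw s hs x hx
    refine traj (G := fun u => ι (w u)) hE.op (hE.knn w) (hE.kint hw) ?_ ?_ ?_ hs hx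
      (fun t ht => hflow w hw s hs t ht x hx)
    · intro y hy
      simp only [← hι _ y hy]
      exact hE.aesm hw aestronglyMeasurable_const
    · intro u y hy
      rw [← hι _ y hy]; exact hE.bd _ _
    · intro u y hy p hp
      rw [← hι _ y hy]
      have := hE.lip (w u) y p
      rwa [hE.zero _ p hp, sub_zero] at this
  refine ⟨fun w hw s hs x hx => (key w hw s hs x hx).2.1,
    fun w hw s hs x hx => (key w hw s hs x hx).2.2, ?_⟩
  intro w hw s hs x hx t ht
  rw [hflow w hw s hs t ht x hx]
  congr 1
  refine intervalIntegral.integral_congr (fun u hu => ?_)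
  exact (hι _ _ ((key w hw s hs x hx).2.1 u (uIcc_subset_Icc hs ht hu))).symm

end flowsec

section flowsec
variable {d : ℕ} {V : Type*} [NormedAddCommGroup V] [InnerProductSpace ℝ V]
    [MeasurableSpace V] [BorelSpace V]
    {Ω : Set (Euc d)} {c : ℝ} {F : V →ₗ[ℝ] (Euc d → Euc d)}
    {Φ : (ℝ → V) → ℝ → ℝ → Euc d → Euc d}

lemma flow_stab (hE : Emb Ω c F) {w : ℝ → V} (hw : InV01 w) :
    ∃ C : ℝ, 0 ≤ C ∧ ∀ s ∈ Icc (0:ℝ) 1, ∀ (γ₁ γ₂ : ℝ → Euc d) (x y : Euc d),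
      ContinuousOn γ₁ (Icc 0 1) → ContinuousOn γ₂ (Icc 0 1) →
      (∀ t ∈ Icc (0:ℝ) 1, γ₁ t = x + ∫ u in s..t, F (w u) (γ₁ u)) →
      (∀ t ∈ Icc (0:ℝ) 1, γ₂ t = y + ∫ u in s..t, F (w u) (γ₂ u)) →
      ∀ t ∈ Icc (0:ℝ) 1, ‖γ₁ t - γ₂ t‖ ≤ C * ‖x - y‖ := by
  obtain ⟨C, hC, H⟩ := gr_vec (d := d) (hE.knn w) (hE.kint hw)
  refine ⟨C, hC, ?_⟩
  intro s hs γ₁ γ₂ x y h1 h2 e1 e2 t ht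
  have := H s hs (fun u => γ₁ u - γ₂ u) (fun u => F (w u) (γ₁ u) - F (w u) (γ₂ u))
    (fun _ => 0) (x - y) (h1.sub h2) integrableOn_zero (fun _ => le_rfl)
    (fun u _ => by simpa using hE.lip (w u) (γ₁ u) (γ₂ u)) ?_ t ht
  · simpa using this
  · intro t ht
    rw [intervalIntegral.integral_sub (ii01 (hE.int hw h1) hs ht) (ii01 (hE.int hw h2) hs ht)]
    rw [e1 t ht, e2 t ht]
    abel

lemma IsFlow.lip (hF : IsFlow Ω F Φ) (hE : Emb Ω c F) {w : ℝ → V} (hw : InV01 w) :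
    ∃ C : ℝ, 0 ≤ C ∧ ∀ s ∈ Icc (0:ℝ) 1, ∀ x ∈ Ω, ∀ y ∈ Ω, ∀ t ∈ Icc (0:ℝ) 1,
      ‖Φ w s t x - Φ w s t y‖ ≤ C * ‖x - y‖ := by
  obtain ⟨C, hC, H⟩ := flow_stab hE hw
  exact ⟨C, hC, fun s hs x hx y hy t ht => H s hs _ _ x y (hF.cont w hw s hs x hx)
    (hF.cont w hw s hs y hy) (hF.eq w hw s hs x hx) (hF.eq w hw s hs y hy) t ht⟩

lemma IsFlow.self (hF : IsFlow Ω F Φ) {w : ℝ → V} (hw : InV01 w) {s : ℝ} (hs : s ∈ Icc (0:ℝ) 1)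
    {x : Euc d} (hx : x ∈ Ω) : Φ w s s x = x := by
  rw [hF.eq w hw s hs x hx s hs]; simp

lemma IsFlow.comp (hF : IsFlow Ω F Φ) (hE : Emb Ω c F) {w : ℝ → V} (hw : InV01 w)
    {s u t : ℝ} (hs : s ∈ Icc (0:ℝ) 1) (hu : u ∈ Icc (0:ℝ) 1) (ht : t ∈ Icc (0:ℝ) 1)
    {x : Euc d} (hx : x ∈ Ω) : Φ w u t (Φ w s u x) = Φ w s t x := by
  obtain ⟨C, hC, H⟩ := flow_stab hE hw
  have hz := hF.mem w hw s hs x hx u hu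
  have hi := hE.int hw (hF.cont w hw s hs x hx)
  have := H u hu (fun t => Φ w u t (Φ w s u x)) (fun t => Φ w s t x) _ (Φ w s u x)
    (hF.cont w hw u hu _ hz) (hF.cont w hw s hs x hx) (hF.eq w hw u hu _ hz) ?_ t ht
  · rw [sub_self, norm_zero, mul_zero] at this
    exact sub_eq_zero.1 (norm_le_zero_iff.1 this)
  · intro t ht
    rw [hF.eq w hw s hs x hx t ht]
    conv_rhs => rw [hF.eq w hw s hs x hx u hu]
    rw [add_assoc, intervalIntegral.integral_add_adjacent_intervals (ii01 hi hs hu)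
      (ii01 hi hu ht)]

lemma lin_unique (hE : Emb Ω c F) {w : ℝ → V} (hw : InV01 w) {γ : ℝ → Euc d}
    (hγ : ContinuousOn γ (Icc 0 1)) (hγΩ : ∀ u ∈ Icc (0:ℝ) 1, γ u ∈ Ω)
    {g ζ₁ ζ₂ : ℝ → Euc d} (hg : IntegrableOn g (Icc 0 1)) {s : ℝ} (hs : s ∈ Icc (0:ℝ) 1)
    (ξ : Euc d) (h1 : ContinuousOn ζ₁ (Icc 0 1)) (h2 : ContinuousOn ζ₂ (Icc 0 1))
    (e1 : ∀ t ∈ Icc (0:ℝ) 1, ζ₁ t = ξ + ∫ u in s..t, (fderiv ℝ (F (w u)) (γ u) (ζ₁ u) + g u))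
    (e2 : ∀ t ∈ Icc (0:ℝ) 1, ζ₂ t = ξ + ∫ u in s..t, (fderiv ℝ (F (w u)) (γ u) (ζ₂ u) + g u)) :
    ∀ t ∈ Icc (0:ℝ) 1, ζ₁ t = ζ₂ t := by
  obtain ⟨C, hC, H⟩ := gr_vec (d := d) (hE.knn w) (hE.kint hw)
  intro t ht
  have := H s hs (fun u => ζ₁ u - ζ₂ u) (fun u => fderiv ℝ (F (w u)) (γ u) (ζ₁ u - ζ₂ u))
    (fun _ => 0) 0 (h1.sub h2) integrableOn_zero (fun _ => le_rfl)
    (fun u _ => by simpa using hE.fderiv_le (w u) (γ u) (ζ₁ u - ζ₂ u)) ?_ t ht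
  · simp only [norm_zero, intervalIntegral.integral_zero, add_zero, mul_zero] at this
    exact sub_eq_zero.1 (norm_le_zero_iff.1 this)
  · intro t ht
    simp only [map_sub]
    have i1 := (ii01 (hE.intD hw hγ hγΩ h1) hs ht)
    have i2 := (ii01 (hE.intD hw hγ hγΩ h2) hs ht)
    have i3 := ii01 hg hs ht
    rw [intervalIntegral.integral_sub i1 i2, e1 t ht, e2 t ht,
      intervalIntegral.integral_add i1 i3, intervalIntegral.integral_add i2 i3]
    abel

end flowsec

section flowsec
variable {d : ℕ} {V : Type*} [NormedAddCommGroup V] [InnerProductSpace ℝ V]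
    [MeasurableSpace V] [BorelSpace V]
    {Ω : Set (Euc d)} {c : ℝ} {F : V →ₗ[ℝ] (Euc d → Euc d)}
    {Φ : (ℝ → V) → ℝ → ℝ → Euc d → Euc d}

/-- Linearised equation for perturbations of the field and of the starting point. -/
lemma pert (hF : IsFlow Ω F Φ) (hE : Emb Ω c F) {w h : ℝ → V} (hw : InV01 w) (hh : InV01 h)
    {s : ℝ} (hs : s ∈ Icc (0:ℝ) 1) {x : Euc d} (hx : x ∈ Ω) (ξ : Euc d) :
    ∃ ζ : ℝ → Euc d, ContinuousOn ζ (Icc 0 1) ∧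
      (∀ t ∈ Icc (0:ℝ) 1, ζ t = ξ + ∫ u in s..t,
        (fderiv ℝ (F (w u)) (Φ w s u x) (ζ u) + F (h u) (Φ w s u x))) ∧
      ∀ t ∈ Icc (0:ℝ) 1,
        HasDerivAt (fun e : ℝ => Φ (fun u => w u + e • h u) s t (x + e • ξ)) (ζ t) 0 := by
  obtain ⟨C, hC, H⟩ := gr_vec (d := d) (hE.knn w) (hE.kint hw)
  set γ : ℝ → Euc d := fun u => Φ w s u x with hγdef
  have hγ : ContinuousOn γ (Icc 0 1) := hF.cont w hw s hs x hx
  have hγΩ : ∀ u ∈ Icc (0:ℝ) 1, γ u ∈ Ω := hF.mem w hw s hs x hx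
  have hγe : ∀ t ∈ Icc (0:ℝ) 1, γ t = x + ∫ u in s..t, F (w u) (γ u) := hF.eq w hw s hs x hx
  set Γ : ℝ → ℝ → Euc d := fun e u => Φ (fun u => w u + e • h u) s u (x + e • ξ) with hΓdef
  set K : ℝ := ∫ u in (0:ℝ)..1, c * ‖h u‖ with hK
  have hK0 : 0 ≤ K := intervalIntegral.integral_nonneg zero_le_one (fun u _ => hE.knn h u)
  set B : ℝ := C * (‖ξ‖ + K) with hB
  have hB0 : 0 ≤ B := by positivity
  have hgood : ∀ᶠ e in 𝓝 (0:ℝ), x + e • ξ ∈ Ω := by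
    have : Continuous (fun e : ℝ => x + e • ξ) := by fun_prop
    have h0 := this.tendsto 0
    simp only [zero_smul, add_zero] at h0
    exact h0.eventually (hE.op.mem_nhds hx)
  have hΓc : ∀ e : ℝ, x + e • ξ ∈ Ω → ContinuousOn (Γ e) (Icc 0 1) := fun e he =>
    hF.cont _ (hw.add_smul hh e) s hs _ he
  have hΓe : ∀ e : ℝ, x + e • ξ ∈ Ω → ∀ t ∈ Icc (0:ℝ) 1,
      Γ e t - γ t = e • ξ + ∫ u in s..t, (F (w u) (Γ e u) - F (w u) (γ u) + e • F (h u) (Γ e u)) := by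
    intro e he t ht
    have h1 := hF.eq _ (hw.add_smul hh e) s hs _ he t ht
    have h2 : Γ e t = x + e • ξ + ∫ u in s..t, F (w u + e • h u) (Γ e u) := h1
    have i1 := ii01 (hE.int hw (hΓc e he)) hs ht
    have i2 := ii01 (hE.int hw hγ) hs ht
    have i3 : IntervalIntegrable (fun u => e • F (h u) (Γ e u)) volume s t :=
      ii01 ((hE.int hh (hΓc e he)).smul e) hs ht
    have h3 : ∀ u, F (w u + e • h u) (Γ e u) = F (w u) (Γ e u) + e • F (h u) (Γ e u) := by
      intro u; simp
    simp only [h3] at h2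
    rw [intervalIntegral.integral_add i1 i3] at h2
    rw [intervalIntegral.integral_add (i1.sub i2) i3, intervalIntegral.integral_sub i1 i2, h2,
      hγe t ht]
    abel
  have hbd : ∀ e : ℝ, x + e • ξ ∈ Ω → ∀ t ∈ Icc (0:ℝ) 1, ‖Γ e t - γ t‖ ≤ B * |e| := by
    intro e he t ht
    have := H s hs (fun u => Γ e u - γ u) _ (fun u => |e| * (c * ‖h u‖)) (e • ξ)
      ((hΓc e he).sub hγ) ((hE.kint hh).const_mul _)
      (fun u => mul_nonneg (abs_nonneg _) (hE.knn h u)) ?_ (hΓe e he) t ht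
    · rw [intervalIntegral.integral_const_mul, norm_smul, Real.norm_eq_abs] at this
      refine this.trans (le_of_eq ?_)
      rw [hB, hK]; ring
    · intro u _
      refine (norm_add_le _ _).trans (add_le_add (hE.lip _ _ _) ?_)
      rw [norm_smul, Real.norm_eq_abs]
      exact mul_le_mul_of_nonneg_left (hE.bd _ _) (abs_nonneg _)
  -- difference quotients
  set q : ℝ → ℝ → Euc d := fun e u => e⁻¹ • (Γ e u - γ u) with hq
  set p : ℝ → ℝ → Euc d := fun e u => e⁻¹ • (F (w u) (Γ e u) - F (w u) (γ u)) + F (h u) (Γ e u)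
    with hp
  set r : ℝ → ℝ → Euc d := fun e u =>
    p e u - fderiv ℝ (F (w u)) (γ u) (q e u) - F (h u) (γ u) with hr
  set l : Filter ℝ := 𝓝[≠] (0:ℝ) with hl
  have hgl : ∀ᶠ e in l, e ≠ 0 ∧ x + e • ξ ∈ Ω :=
    (eventually_mem_nhdsWithin.mono fun e he => he).and (hgood.filter_mono nhdsWithin_le_nhds)
  have hqc : ∀ e : ℝ, x + e • ξ ∈ Ω → ContinuousOn (q e) (Icc 0 1) := fun e he =>
    ((hΓc e he).sub hγ).const_smul (e⁻¹ : ℝ)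
  have hqb : ∀ e : ℝ, e ≠ 0 → x + e • ξ ∈ Ω → ∀ u ∈ Icc (0:ℝ) 1, ‖q e u‖ ≤ B := by
    intro e he0 he u hu
    rw [hq]; simp only
    rw [norm_smul, norm_inv, Real.norm_eq_abs, inv_mul_le_iff₀ (abs_pos.2 he0), mul_comm]
    exact hbd e he u hu
  have hpi : ∀ e : ℝ, x + e • ξ ∈ Ω → IntegrableOn (p e) (Icc 0 1) := fun e he =>
    (((hE.int hw (hΓc e he)).sub (hE.int hw hγ)).smul (e⁻¹ : ℝ)).add (hE.int hh (hΓc e he))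
  have hqe : ∀ e : ℝ, e ≠ 0 → x + e • ξ ∈ Ω → ∀ t ∈ Icc (0:ℝ) 1,
      q e t = ξ + ∫ u in s..t, p e u := by
    intro e he0 he t ht
    rw [hq]; simp only
    rw [hΓe e he t ht, smul_add, inv_smul_smul₀ he0, ← intervalIntegral.integral_smul]
    congr 1
    refine intervalIntegral.integral_congr (fun u _ => ?_)
    simp only [hp, smul_add, inv_smul_smul₀ he0]
  have hpb : ∀ e : ℝ, e ≠ 0 → x + e • ξ ∈ Ω → ∀ u ∈ Icc (0:ℝ) 1,
      ‖p e u‖ ≤ c * ‖w u‖ * B + c * ‖h u‖ := by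
    intro e he0 he u hu
    refine (norm_add_le _ _).trans (add_le_add ?_ (hE.bd _ _))
    rw [norm_smul, norm_inv, Real.norm_eq_abs, inv_mul_le_iff₀ (abs_pos.2 he0)]
    refine (hE.lip _ _ _).trans ?_
    have := mul_le_mul_of_nonneg_left (hbd e he u hu) (hE.knn w u)
    linarith
  have hri : ∀ e : ℝ, x + e • ξ ∈ Ω → IntegrableOn (r e) (Icc 0 1) := fun e he =>
    ((hpi e he).sub (hE.intD hw hγ hγΩ (hqc e he))).sub (hE.int hh hγ)
  have hrb : ∀ e : ℝ, e ≠ 0 → x + e • ξ ∈ Ω → ∀ u ∈ Icc (0:ℝ) 1,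
      ‖r e u‖ ≤ 2 * B * (c * ‖w u‖) + 2 * (c * ‖h u‖) := by
    intro e he0 he u hu
    have h1 := norm_sub_le (p e u - fderiv ℝ (F (w u)) (γ u) (q e u)) (F (h u) (γ u))
    have h2 := norm_sub_le (p e u) (fderiv ℝ (F (w u)) (γ u) (q e u))
    have h3 := hpb e he0 he u hu
    have h4 := hE.fderiv_le (w u) (γ u) (q e u)
    have h5 := mul_le_mul_of_nonneg_left (hqb e he0 he u hu) (hE.knn w u)
    have h6 := hE.bd (h u) (γ u)
    have : ‖r e u‖ = ‖p e u - fderiv ℝ (F (w u)) (γ u) (q e u) - F (h u) (γ u)‖ := rfl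
    linarith
  have hΓO : ∀ u ∈ Icc (0:ℝ) 1, (fun e => Γ e u - γ u) =O[l] (fun e : ℝ => e) := by
    intro u hu
    refine Asymptotics.IsBigO.of_bound B ?_
    filter_upwards [hgl] with e he
    exact hbd e he.2 u hu
  have hid : Tendsto (fun e : ℝ => e) l (𝓝 0) := nhdsWithin_le_nhds
  have hΓt : ∀ u ∈ Icc (0:ℝ) 1, Tendsto (fun e => Γ e u) l (𝓝 (γ u)) := by
    intro u hu
    have := ((hΓO u hu).trans_tendsto hid).add_const (γ u)
    simpa using this
  have hr0 : ∀ u ∈ Icc (0:ℝ) 1, Tendsto (fun e => r e u) l (𝓝 0) := by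
    intro u hu
    have h1 := (hE.diff (w u) _ (hγΩ u hu)).hasFDerivAt.isLittleO
    have h2 := (h1.comp_tendsto (hΓt u hu)).trans_isBigO (hΓO u hu)
    have h3 := h2.tendsto_inv_smul_nhds_zero
    have h4 : Tendsto (fun e => F (h u) (Γ e u) - F (h u) (γ u)) l (𝓝 0) := by
      have hcont := (hE.diff (h u) _ (hγΩ u hu)).continuousAt
      have := (hcont.tendsto.comp (hΓt u hu)).sub_const (F (h u) (γ u))
      simpa using this
    have h5 := h3.add h4
    rw [add_zero] at h5
    refine h5.congr (fun e => ?_)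
    simp only [hr, hp, hq, Function.comp]
    rw [map_smul]
    module
  set ρ : ℝ → ℝ := fun e => ∫ u in (0:ℝ)..1, ‖r e u‖ with hρ
  have hρ0 : Tendsto ρ l (𝓝 0) := by
    have : Tendsto ρ l (𝓝 (∫ u in (0:ℝ)..1, (0:ℝ))) := by
      refine intervalIntegral.tendsto_integral_filter_of_dominated_convergence
        (fun u => 2 * B * (c * ‖w u‖) + 2 * (c * ‖h u‖)) ?_ ?_ ?_ ?_
      · filter_upwards [hgl] with e he
        rw [uIoc_of_le zero_le_one]
        exact ((hri e he.2).mono_set Ioc_subset_Icc_self).aestronglyMeasurable.norm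
      · filter_upwards [hgl] with e he
        refine ae_of_all _ (fun u hu => ?_)
        rw [uIoc_of_le zero_le_one] at hu
        rw [norm_norm]
        exact hrb e he.1 he.2 u (Ioc_subset_Icc_self hu)
      · exact ii01 (((hE.kint hw).const_mul _).add ((hE.kint hh).const_mul _))
          (by simp) (by simp)
      · refine ae_of_all _ (fun u hu => ?_)
        rw [uIoc_of_le zero_le_one] at hu
        simpa using (hr0 u (Ioc_subset_Icc_self hu)).norm
    simpa using this
  have hcau : ∀ e e' : ℝ, e ≠ 0 → x + e • ξ ∈ Ω → e' ≠ 0 → x + e' • ξ ∈ Ω →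
      ∀ t ∈ Icc (0:ℝ) 1, ‖q e t - q e' t‖ ≤ C * (ρ e + ρ e') := by
    intro e e' he0 he he0' he' t ht
    have := H s hs (fun u => q e u - q e' u) (fun u => p e u - p e' u)
      (fun u => ‖r e u‖ + ‖r e' u‖) 0
      ((hqc e he).sub (hqc e' he')) ((hri e he).norm.add (hri e' he').norm)
      (fun u => by positivity) ?_ ?_ t ht
    · rw [intervalIntegral.integral_add (ii01 (hri e he).norm (by simp) (by simp))
        (ii01 (hri e' he').norm (by simp) (by simp)), norm_zero, zero_add] at this
      exact this
    · intro u _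
      have h1 : p e u - p e' u = fderiv ℝ (F (w u)) (γ u) (q e u - q e' u) + (r e u - r e' u) := by
        simp only [hr, map_sub]; abel
      rw [h1]
      exact (norm_add_le _ _).trans (add_le_add (hE.fderiv_le _ _ _) (norm_sub_le _ _))
    · intro t ht
      rw [intervalIntegral.integral_sub (ii01 (hpi e he) hs ht) (ii01 (hpi e' he') hs ht),
        hqe e he0 he t ht, hqe e' he0' he' t ht]
      abel
  have hUC : UniformCauchySeqOn q l (Icc 0 1) := by
    intro U hU
    obtain ⟨δ, hδ, hδU⟩ := Metric.mem_uniformity_dist.1 hU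
    have h1 : Tendsto (fun m : ℝ × ℝ => C * (ρ m.1 + ρ m.2)) (l ×ˢ l) (𝓝 0) := by
      have := ((hρ0.comp tendsto_fst).add (hρ0.comp (tendsto_snd (f := l)))).const_mul C
      simpa using this
    filter_upwards [h1.eventually_lt_const hδ, hgl.prod_mk hgl] with m hm hg t ht
    refine hδU ?_
    rw [dist_eq_norm]
    exact (hcau _ _ hg.1.1 hg.1.2 hg.2.1 hg.2.2 t ht).trans_lt hm
  have hex : ∀ t, ∃ z, t ∈ Icc (0:ℝ) 1 → Tendsto (fun e => q e t) l (𝓝 z) := by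
    intro t
    by_cases ht : t ∈ Icc (0:ℝ) 1
    · obtain ⟨z, hz⟩ := cauchy_map_iff_exists_tendsto.1 (hUC.cauchy_map ht)
      exact ⟨z, fun _ => hz⟩
    · exact ⟨0, fun h => absurd h ht⟩
  choose ζ hζ using hex
  have hU := hUC.tendstoUniformlyOn_of_tendsto (fun t ht => hζ t ht)
  have hζc : ContinuousOn ζ (Icc 0 1) :=
    hU.continuousOn (hgl.mono fun e he => hqc e he.2).frequently
  refine ⟨ζ, hζc, ?_, ?_⟩
  · intro t ht
    have h1 : Tendsto (fun e => ξ + ∫ u in s..t, p e u) l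
        (𝓝 (ξ + ∫ u in s..t, (fderiv ℝ (F (w u)) (γ u) (ζ u) + F (h u) (γ u)))) := by
      refine Tendsto.const_add _ ?_
      have hsub : uIoc s t ⊆ Icc (0:ℝ) 1 := uIoc_subset_uIcc.trans (uIcc_subset_Icc hs ht)
      refine intervalIntegral.tendsto_integral_filter_of_dominated_convergence
        (fun u => c * ‖w u‖ * B + c * ‖h u‖) ?_ ?_ ?_ ?_
      · filter_upwards [hgl] with e he
        exact ((hpi e he.2).mono_set hsub).aestronglyMeasurable
      · filter_upwards [hgl] with e he
        exact ae_of_all _ (fun u hu => hpb e he.1 he.2 u (hsub hu))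
      · exact ii01 (((hE.kint hw).mul_const _).add (hE.kint hh)) hs ht
      · refine ae_of_all _ (fun u hu => ?_)
        have h2 := ((hr0 u (hsub hu)).add
          (((fderiv ℝ (F (w u)) (γ u)).continuous.tendsto _).comp (hζ u (hsub hu)))).add_const
          (F (h u) (γ u))
        rw [zero_add] at h2
        refine h2.congr (fun e => ?_)
        simp only [hr, Function.comp]; abel
    refine tendsto_nhds_unique (hζ t ht) (h1.congr' ?_)
    filter_upwards [hgl] with e he
    exact (hqe e he.1 he.2 t ht).symm
  · intro t ht
    rw [hasDerivAt_iff_tendsto_slope_zero]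
    refine (hζ t ht).congr (fun e => ?_)
    simp [hq, hΓdef, hγdef]

end flowsec

section flowsec
variable {d : ℕ} {V : Type*} [NormedAddCommGroup V] [InnerProductSpace ℝ V]
    [MeasurableSpace V] [BorelSpace V]
    {Ω : Set (Euc d)} {c : ℝ} {F : V →ₗ[ℝ] (Euc d → Euc d)}
    {Φ : (ℝ → V) → ℝ → ℝ → Euc d → Euc d}

lemma flow_frechet (hF : IsFlow Ω F Φ) (hE : Emb Ω c F) {w : ℝ → V} (hw : InV01 w)
    {s : ℝ} (hs : s ∈ Icc (0:ℝ) 1) {x : Euc d} (hx : x ∈ Ω) :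
    ∃ M : ℝ → Euc d →L[ℝ] Euc d,
      (∀ t ∈ Icc (0:ℝ) 1, HasFDerivAt (Φ w s t) (M t) x) ∧
      (∀ ξ, ContinuousOn (fun t => M t ξ) (Icc 0 1)) ∧
      (∀ ξ, ∀ t ∈ Icc (0:ℝ) 1, M t ξ = ξ + ∫ u in s..t,
        fderiv ℝ (F (w u)) (Φ w s u x) (M u ξ)) := by
  have h0 : InV01 (fun _ : ℝ => (0:V)) := ⟨measurable_const, by simp⟩
  have hγ := hF.cont w hw s hs x hx
  have hγΩ := hF.mem w hw s hs x hx
  have hP := fun ξ => pert hF hE hw h0 hs hx ξ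
  have hz : ∀ u, F (0:V) u = 0 := fun u => by rw [map_zero]; rfl
  simp only [smul_zero, add_zero, hz] at hP
  choose ζ hc he hd using hP
  have hadd : ∀ ξ η, ∀ t ∈ Icc (0:ℝ) 1, ζ (ξ + η) t = ζ ξ t + ζ η t := by
    intro ξ η
    refine lin_unique hE hw hγ hγΩ (g := fun _ => 0) integrableOn_zero hs (ξ + η) (hc _)
      ((hc ξ).add (hc η)) ?_ ?_
    · simpa using he (ξ + η)
    · intro t ht
      simp only [add_zero, map_add]
      rw [intervalIntegral.integral_add (ii01 (hE.intD hw hγ hγΩ (hc ξ)) hs ht)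
        (ii01 (hE.intD hw hγ hγΩ (hc η)) hs ht), he ξ t ht, he η t ht]
      abel
  have hsmul : ∀ (a : ℝ) ξ, ∀ t ∈ Icc (0:ℝ) 1, ζ (a • ξ) t = a • ζ ξ t := by
    intro a ξ
    refine lin_unique hE hw hγ hγΩ (g := fun _ => 0) integrableOn_zero hs (a • ξ) (hc _)
      ((hc ξ).const_smul a) ?_ ?_
    · simpa using he (a • ξ)
    · intro t ht
      simp only [add_zero, map_smul]
      rw [intervalIntegral.integral_smul, he ξ t ht, smul_add]
  have hM : ∀ t, ∃ M : Euc d →L[ℝ] Euc d, t ∈ Icc (0:ℝ) 1 → ∀ ξ, M ξ = ζ ξ t := by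
    intro t
    by_cases ht : t ∈ Icc (0:ℝ) 1
    · let L : Euc d →ₗ[ℝ] Euc d :=
        { toFun := fun ξ => ζ ξ t
          map_add' := fun ξ η => hadd ξ η t ht
          map_smul' := fun a ξ => hsmul a ξ t ht }
      exact ⟨LinearMap.toContinuousLinearMap L, fun _ ξ => rfl⟩
    · exact ⟨0, fun h => absurd h ht⟩
  choose M hM using hM
  refine ⟨M, ?_, ?_, ?_⟩
  · intro t ht
    obtain ⟨C, hC, hlip⟩ := hF.lip hE hw
    have hL : LipschitzOnWith ⟨C, hC⟩ (Φ w s t) Ω := LipschitzOnWith.of_dist_le_mul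
      (fun a ha b hb => by
        rw [dist_eq_norm, dist_eq_norm]; exact hlip s hs a ha b hb t ht)
    obtain ⟨g, hg, hgeq⟩ := hL.extend_finite_dimension
    have hev : Φ w s t =ᶠ[𝓝 x] g := hgeq.eventuallyEq_of_mem (hE.op.mem_nhds hx)
    refine HasFDerivAt.congr_of_eventuallyEq ?_ hev
    refine hg.hasFDerivAt_of_hasLineDerivAt_of_closure (s := univ) (by simp) (fun ξ _ => ?_)
    have h1 : HasLineDerivAt ℝ (Φ w s t) (M t ξ) x ξ := by
      rw [hM t ht]; exact hd ξ t ht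
    exact h1.congr_of_eventuallyEq hev.symm
  · intro ξ
    exact (hc ξ).congr (fun t ht => hM t ht ξ)
  · intro ξ t ht
    rw [hM t ht, he ξ t ht]
    congr 1
    refine intervalIntegral.integral_congr (fun u hu => ?_)
    rw [hM u (uIcc_subset_Icc hs ht hu)]

end flowsec

lemma prod_rule_vec {d : ℕ} {f : ℝ → Euc d} {g : ℝ → ℝ} {z : Euc d} {s t : ℝ}
    (hs : s ∈ Icc (0:ℝ) 1) (ht : t ∈ Icc (0:ℝ) 1)
    (hf : IntegrableOn f (Icc 0 1)) (hg : IntegrableOn g (Icc 0 1))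
    (hi : IntervalIntegrable (fun u => (∫ r in s..u, g r) • f u +
      g u • (z + ∫ r in s..u, f r)) volume s t) :
    (∫ u in s..t, g u) • (z + ∫ u in s..t, f u) =
      ∫ u in s..t, ((∫ r in s..u, g r) • f u + g u • (z + ∫ r in s..u, f r)) := by
  ext i
  have hp : ∀ y : Euc d, y i = EuclideanSpace.proj (𝕜 := ℝ) i y := fun y => rfl
  have hfi : ∀ a b, a ∈ Icc (0:ℝ) 1 → b ∈ Icc (0:ℝ) 1 →
      EuclideanSpace.proj (𝕜 := ℝ) i (∫ u in a..b, f u) = ∫ u in a..b, f u i := fun a b ha hb =>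
    ((EuclideanSpace.proj (𝕜 := ℝ) i : Euc d →L[ℝ] ℝ).intervalIntegral_comp_comm
      (ii01 hf ha hb)).symm
  have hf' : IntegrableOn (fun u => f u i) (Icc 0 1) :=
    (EuclideanSpace.proj (𝕜 := ℝ) i : Euc d →L[ℝ] ℝ).integrable_comp hf
  rw [hp, hp, ← ContinuousLinearMap.intervalIntegral_comp_comm _ hi]
  rw [map_smul, map_add, hfi s t hs ht, smul_eq_mul, mul_comm, ← hp,
    prod_rule (ii01 hf' hs ht) (ii01 hg hs ht)]
  refine intervalIntegral.integral_congr (fun u hu => ?_)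
  simp only [map_add, map_smul, smul_eq_mul]
  rw [hfi s u hs (uIcc_subset_Icc hs ht hu)]
  simp only [← hp]
  ring

lemma duhamel {d : ℕ} {M A : ℝ → Euc d →L[ℝ] Euc d} {b : ℝ → Euc d} {s : ℝ}
    (hs : s ∈ Icc (0:ℝ) 1)
    (hMc : ∀ ξ, ContinuousOn (fun t => M t ξ) (Icc 0 1))
    (hAi : ∀ ξ, IntegrableOn (fun u => A u (M u ξ)) (Icc 0 1))
    (hM : ∀ ξ, ∀ t ∈ Icc (0:ℝ) 1, M t ξ = ξ + ∫ u in s..t, A u (M u ξ))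
    (hb : IntegrableOn b (Icc 0 1)) :
    ∀ t ∈ Icc (0:ℝ) 1, M t (∫ u in s..t, b u) =
      ∫ u in s..t, (A u (M u (∫ r in s..u, b r)) + M u (b u)) := by
  intro t ht
  let e : Fin d → Euc d := fun j => EuclideanSpace.single j 1
  have hsum : ∀ y : Euc d, y = ∑ j, y j • e j := by
    intro y
    have := (EuclideanSpace.basisFun (Fin d) ℝ).sum_repr y
    simpa [e] using this.symm
  have hbj : ∀ j, IntegrableOn (fun u => b u j) (Icc 0 1) := fun j =>
    (EuclideanSpace.proj (𝕜 := ℝ) j : Euc d →L[ℝ] ℝ).integrable_comp hb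
  have hYj : ∀ j, ∀ u ∈ Icc (0:ℝ) 1, (∫ r in s..u, b r) j = ∫ r in s..u, b r j := fun j u hu =>
    ((EuclideanSpace.proj (𝕜 := ℝ) j : Euc d →L[ℝ] ℝ).intervalIntegral_comp_comm
      (ii01 hb hs hu)).symm
  have hYc : ∀ j, ContinuousOn (fun u => ∫ r in s..u, b r j) (Icc 0 1) := by
    intro j
    have := intervalIntegral.continuousOn_primitive_interval' (a := s)
      (ii01 (hbj j) (s := 0) (t := 1) (by simp) (by simp))
      (by rwa [uIcc_of_le zero_le_one])
    rwa [uIcc_of_le zero_le_one] at this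
  have hint : ∀ j, IntegrableOn (fun u => (∫ r in s..u, b r j) • A u (M u (e j)) +
      b u j • M u (e j)) (Icc 0 1) := fun j =>
    ((hAi (e j)).continuousOn_smul (hYc j) isCompact_Icc).add
      ((hbj j).smul_continuousOn (hMc (e j)) isCompact_Icc)
  have hcong : ∀ j, ∀ u ∈ uIcc s t, (∫ r in s..u, b r j) • A u (M u (e j)) + b u j • M u (e j) =
      (∫ r in s..u, b r j) • A u (M u (e j)) +
        b u j • (e j + ∫ r in s..u, A r (M r (e j))) := by
    intro j u hu
    rw [← hM _ u (uIcc_subset_Icc hs ht hu)]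
  have h1 : M t (∫ u in s..t, b u) = ∑ j, ∫ u in s..t,
      ((∫ r in s..u, b r j) • A u (M u (e j)) + b u j • M u (e j)) := by
    conv_lhs => rw [hsum (∫ u in s..t, b u), map_sum]
    refine Finset.sum_congr rfl (fun j _ => ?_)
    rw [map_smul, hYj j t ht, hM (e j) t ht, prod_rule_vec hs ht (hAi (e j)) (hbj j)]
    · exact (intervalIntegral.integral_congr (hcong j)).symm
    · refine (ii01 (hint j) hs ht).congr (fun u hu => ?_)
      exact hcong j u (uIoc_subset_uIcc hu)
  rw [h1, ← intervalIntegral.integral_finset_sum (fun j _ => ii01 (hint j) hs ht)]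
  refine intervalIntegral.integral_congr (fun u hu => ?_)
  simp only
  conv_rhs => rw [hsum (∫ u in s..u, b u), hsum (b u)]
  simp only [map_sum, map_smul]
  rw [← Finset.sum_add_distrib]
  refine Finset.sum_congr rfl (fun j _ => ?_)
  rw [hYj j u (uIcc_subset_Icc hs ht hu)]


section flowsec
variable {d : ℕ} {V : Type*} [NormedAddCommGroup V] [InnerProductSpace ℝ V]
    [MeasurableSpace V] [BorelSpace V]
    {Ω : Set (Euc d)} {c : ℝ} {F : V →ₗ[ℝ] (Euc d → Euc d)}
    {Φ : (ℝ → V) → ℝ → ℝ → Euc d → Euc d}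

lemma flow_deriv (hF : IsFlow Ω F Φ) (hE : Emb Ω c F) {w h : ℝ → V} (hw : InV01 w)
    (hh : InV01 h) {s t : ℝ} (hs : s ∈ Icc (0:ℝ) 1) (ht : t ∈ Icc (0:ℝ) 1)
    {x : Euc d} (hx : x ∈ Ω) :
    HasDerivAt (fun e : ℝ => Φ (fun u => w u + e • h u) s t x)
      (∫ u in s..t, fderiv ℝ (Φ w u t) (Φ w s u x) (F (h u) (Φ w s u x))) 0 := by
  obtain ⟨ζ, hζc, hζe, hζd⟩ := pert hF hE hw hh hs hx 0
  have hd := hζd t ht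
  simp only [smul_zero, add_zero] at hd
  suffices hmain : ζ t = ∫ u in s..t, fderiv ℝ (Φ w u t) (Φ w s u x) (F (h u) (Φ w s u x)) by
    rwa [hmain] at hd
  obtain ⟨M, hMd, hMc, hMe⟩ := flow_frechet hF hE hw hs hx
  have hγ := hF.cont w hw s hs x hx
  have hγΩ := hF.mem w hw s hs x hx
  have hMC : ContinuousOn M (Icc 0 1) := continuousOn_clm_apply.2 hMc
  set N : ℝ → Euc d →L[ℝ] Euc d := fun u => fderiv ℝ (Φ w u s) (Φ w s u x) with hN
  have hNd : ∀ u ∈ Icc (0:ℝ) 1, HasFDerivAt (Φ w u s) (N u) (Φ w s u x) := by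
    intro u hu
    obtain ⟨M', hM', -⟩ := flow_frechet hF hE hw hu (hγΩ u hu)
    exact (hM' s hs).differentiableAt.hasFDerivAt
  have hback : ∀ u ∈ Icc (0:ℝ) 1, Φ w u s (Φ w s u x) = x := by
    intro u hu
    rw [hF.comp hE hw hs hu hs hx, hF.self hw hs hx]
  have hchain : ∀ u ∈ Icc (0:ℝ) 1, ∀ r ∈ Icc (0:ℝ) 1,
      HasFDerivAt (Φ w u r) ((M r).comp (N u)) (Φ w s u x) := by
    intro u hu r hr
    have h1 : HasFDerivAt (Φ w s r) (M r) (Φ w u s (Φ w s u x)) := by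
      rw [hback u hu]; exact hMd r hr
    refine (h1.comp _ (hNd u hu)).congr_of_eventuallyEq ?_
    filter_upwards [hE.op.mem_nhds (hγΩ u hu)] with y hy
    exact (hF.comp hE hw hu hs hr hy).symm
  have hMN : ∀ u ∈ Icc (0:ℝ) 1, (M u) * (N u) = 1 := by
    intro u hu
    refine (hchain u hu u hu).unique ((hasFDerivAt_id _).congr_of_eventuallyEq ?_)
    filter_upwards [hE.op.mem_nhds (hγΩ u hu)] with y hy
    exact hF.self hw hu hy
  have hNM : ∀ u ∈ Icc (0:ℝ) 1, (N u) * (M u) = 1 := by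
    intro u hu
    have h1 := (hNd u hu).comp x (hMd u hu)
    refine h1.unique ((hasFDerivAt_id _).congr_of_eventuallyEq ?_)
    filter_upwards [hE.op.mem_nhds hx] with y hy
    simp only [Function.comp, id]
    rw [hF.comp hE hw hs hu hs hy, hF.self hw hs hy]
  have hNC : ContinuousOn N (Icc 0 1) := by
    intro u hu
    let U : ∀ r ∈ Icc (0:ℝ) 1, (Euc d →L[ℝ] Euc d)ˣ := fun r hr =>
      ⟨M r, N r, hMN r hr, hNM r hr⟩
    have h1 : ContinuousAt Ring.inverse (M u) := NormedRing.inverse_continuousAt (U u hu)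
    have h2 : ContinuousWithinAt (fun r => Ring.inverse (M r)) (Icc 0 1) u :=
      h1.comp_continuousWithinAt (hMC u hu)
    have h3 : ∀ r ∈ Icc (0:ℝ) 1, N r = Ring.inverse (M r) := fun r hr =>
      (Ring.inverse_unit (U r hr)).symm
    exact h2.congr h3 (h3 u hu)
  have hg := hE.int hh hγ
  set b : ℝ → Euc d := fun u => N u (F (h u) (Φ w s u x)) with hb
  have hbi : IntegrableOn b (Icc 0 1) := by
    refine (IntegrableOn.continuousOn_mul hNC.norm hg.norm isCompact_Icc).mono' ?_
      (ae_of_all _ fun u => (N u).le_opNorm _)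
    exact isBoundedBilinearMap_apply.continuous.comp_aestronglyMeasurable
      ((hNC.aestronglyMeasurable measurableSet_Icc).prodMk hg.aestronglyMeasurable)
  have hYc : ContinuousOn (fun u => ∫ r in s..u, b r) (Icc 0 1) := by
    have := intervalIntegral.continuousOn_primitive_interval' (a := s)
      (ii01 hbi (s := 0) (t := 1) (by simp) (by simp))
      (by rwa [uIcc_of_le zero_le_one])
    rwa [uIcc_of_le zero_le_one] at this
  have hD := duhamel (A := fun u => fderiv ℝ (F (w u)) (Φ w s u x)) hs hMc
    (fun ξ => hE.intD hw hγ hγΩ (hMc ξ)) hMe hbi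
  have huniq := lin_unique hE hw hγ hγΩ hg hs 0 hζc (hMC.clm_apply hYc) hζe ?_ t ht
  · rw [huniq, ← ContinuousLinearMap.intervalIntegral_comp_comm _ (ii01 hbi hs ht)]
    refine intervalIntegral.integral_congr (fun u hu => ?_)
    have hu' := uIcc_subset_Icc hs ht hu
    rw [(hchain u hu' t ht).fderiv]
    rfl
  · intro r hr
    rw [zero_add, hD r hr]
    refine intervalIntegral.integral_congr (fun u hu => ?_)
    have hu' := uIcc_subset_Icc hs hr hu
    congr 1
    have := congrArg (fun L : Euc d →L[ℝ] Euc d => L (F (h u) (Φ w s u x))) (hMN u hu')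
    exact this

end flowsec

/-- differentiability of the flow in the vector field: for
`v, h ∈ V^{[0,1]}`, `∂_ε φ^{v+εh}_{st}(x) = ∫_s^t (Dφ^{v+εh}_{ut} h_u) ∘ φ^{v+εh}_{su}(x) du`. -/
theorem stmt_10 {d : ℕ} (Ω : Set (Euc d)) (hΩo : IsOpen Ω) (hΩb : Bornology.IsBounded Ω)
    (V : Type*) [NormedAddCommGroup V] [InnerProductSpace ℝ V] [CompleteSpace V]
    [MeasurableSpace V] [BorelSpace V]
    (ι : V →ₗ[ℝ] (Euc d → Euc d)) (hinj : Function.Injective ι)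
    (c : ℝ) (hc : 0 < c)
    (hemb : ∀ f : V, MemC0k 1 Ω (ι f) ∧ CknormOn 1 Ω (ι f) ≤ c * ‖f‖)
    (Φ : (ℝ → V) → ℝ → ℝ → Euc d → Euc d)
    (hflow : ∀ v : ℝ → V, InV01 v → ∀ s ∈ Icc (0:ℝ) 1, ∀ t ∈ Icc (0:ℝ) 1, ∀ x ∈ Ω,
      Φ v s t x = x + ∫ u in s..t, ι (v u) (Φ v s u x))
    (v h : ℝ → V) (hv : InV01 v) (hh : InV01 h) :
    ∀ x ∈ Ω, ∀ s ∈ Icc (0:ℝ) 1, ∀ t ∈ Icc (0:ℝ) 1, ∀ ε : ℝ,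
      HasDerivAt (fun e : ℝ => Φ (fun u => v u + e • h u) s t x)
        (∫ u in s..t,
          (fderiv ℝ (Φ (fun r => v r + ε • h r) u t) (Φ (fun r => v r + ε • h r) s u x))
            (ι (h u) (Φ (fun r => v r + ε • h r) s u x)))
        ε := by
  intro x hx s hs t ht ε
  have hE := extMap_emb Ω hΩo hΩb ι c hc hemb
  have hF : IsFlow Ω (extMap Ω ι) Φ :=
    isFlow_of hE ι (fun f y hy => extMap_eq Ω ι f hy) hflow
  have hw := hv.add_smul hh ε
  have key := flow_deriv hF hE hw hh hs ht hx
  rw [← sub_self ε] at key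
  have h2 := HasDerivAt.comp_sub_const ε ε key
  have h3 : (fun e : ℝ => Φ (fun u => v u + e • h u) s t x) =
      fun e : ℝ => Φ (fun u => v u + ε • h u + (e - ε) • h u) s t x := by
    funext e
    congr 1
    funext u
    module
  rw [h3]
  refine h2.congr_deriv ?_
  refine intervalIntegral.integral_congr (fun u hu => ?_)
  rw [extMap_eq Ω ι (h u) (hF.mem _ hw s hs x hx u (uIcc_subset_Icc hs ht hu))]
end
end
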